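/- arXiv:2210.02423 — 8 statements merged into one kernel-verified Lean document; each statement's English description precedes it below -/
import Mathlib

section
/- Graded anti-commutativity of the symmetric product (Theorem 2, part 1): for all φ ∈ S_{i,j} and ω ∈ S_{r,s} and all integers m,n with 0 ≤ m ≤ min(i,r) and 0 ≤ n ≤ min(j,s), one has φ ⊙_{m,n} ω = (−1)^{m+n} · (ω ⊙_{m,n} φ). -/
open MvPolynomial Finset

noncomputable section

/-- Iterated partial derivatives `∂x^a ∂y^b ∂u^c ∂v^d` on `ℂ[x,y,u,v]`,
with variables `x = X 0`, `y = X 1`, `u = X 2`, `v = X 3`. -/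
def Dop (a b c d : ℕ) (P : MvPolynomial (Fin 4) ℂ) : MvPolynomial (Fin 4) ℂ :=
  (fun Q => pderiv (0 : Fin 4) Q)^[a] <|
  (fun Q => pderiv (1 : Fin 4) Q)^[b] <|
  (fun Q => pderiv (2 : Fin 4) Q)^[c] <|
  (fun Q => pderiv (3 : Fin 4) Q)^[d] P

/-- `SS k l P`: `P ∈ S_{k,l}`, i.e. `P` is bihomogeneous of degree `k` in `(x,y)`
and degree `l` in `(u,v)`. -/
def SS (k l : ℕ) (P : MvPolynomial (Fin 4) ℂ) : Prop :=
  MvPolynomial.IsWeightedHomogeneous (![1, 1, 0, 0] : Fin 4 → ℕ) P k ∧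
  MvPolynomial.IsWeightedHomogeneous (![0, 0, 1, 1] : Fin 4 → ℕ) P l

/-- The symmetric product `φ ⊙_{m,n} ψ` for `φ ∈ S_{i,j}`, `ψ ∈ S_{k,l}`;
defined to be `0` if `(m,n)` lies outside `0 ≤ m ≤ min(i,k)`, `0 ≤ n ≤ min(j,l)`. -/
def symProd (i j k l : ℕ) (m n : ℤ) (φ ψ : MvPolynomial (Fin 4) ℂ) :
    MvPolynomial (Fin 4) ℂ :=
  if 0 ≤ m ∧ m ≤ min (i : ℤ) (k : ℤ) ∧ 0 ≤ n ∧ n ≤ min (j : ℤ) (l : ℤ) then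
    ((((i - m.toNat).factorial * (k - m.toNat).factorial * (j - n.toNat).factorial *
        (l - n.toNat).factorial : ℕ) : ℂ) /
      (((i.factorial * k.factorial * j.factorial * l.factorial : ℕ)) : ℂ)) •
    ∑ a ∈ Finset.range (m.toNat + 1), ∑ b ∈ Finset.range (n.toNat + 1),
      ((-1 : ℂ) ^ (a + b) * (m.toNat.choose a : ℂ) * (n.toNat.choose b : ℂ)) •
        (Dop a (m.toNat - a) b (n.toNat - b) φ *
          Dop (m.toNat - a) a (n.toNat - b) b ψ)
  else 0

/-- Theorem 2, part 1: graded anti-commutativity of the symmetric product. -/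
theorem stmt0 (i j r s m n : ℕ) (φ ω : MvPolynomial (Fin 4) ℂ)
    (hφ : SS i j φ) (hω : SS r s ω)
    (hm : m ≤ min i r) (hn : n ≤ min j s) :
    symProd i j r s (m : ℤ) (n : ℤ) φ ω =
      ((-1 : ℂ) ^ (m + n)) • symProd r s i j (m : ℤ) (n : ℤ) ω φ := by
  unfold symProd
  have h1 : (0:ℤ) ≤ m ∧ (m:ℤ) ≤ min (i : ℤ) (r : ℤ) ∧ (0:ℤ) ≤ n ∧ (n:ℤ) ≤ min (j : ℤ) (s : ℤ) := by
    omega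
  have h2 : (0:ℤ) ≤ m ∧ (m:ℤ) ≤ min (r : ℤ) (i : ℤ) ∧ (0:ℤ) ≤ n ∧ (n:ℤ) ≤ min (s : ℤ) (j : ℤ) := by
    omega
  rw [if_pos h1, if_pos h2]
  simp only [Int.toNat_natCast]
  rw [smul_comm ((-1 : ℂ) ^ (m + n))]
  congr 1
  · push_cast
    ring
  rw [← Finset.sum_range_reflect, Finset.smul_sum]
  refine Finset.sum_congr rfl fun a ha => ?_
  rw [← Finset.sum_range_reflect, Finset.smul_sum]
  refine Finset.sum_congr rfl fun b hb => ?_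
  have ha' : a ≤ m := Nat.lt_succ_iff.mp (Finset.mem_range.mp ha)
  have hb' : b ≤ n := Nat.lt_succ_iff.mp (Finset.mem_range.mp hb)
  have e1 : m + 1 - 1 - a = m - a := by omega
  have e2 : n + 1 - 1 - b = n - b := by omega
  rw [e1, e2, Nat.sub_sub_self ha', Nat.sub_sub_self hb', Nat.choose_symm ha',
    Nat.choose_symm hb', smul_smul, mul_comm (Dop (m - a) a (n - b) b φ)]
  congr 1
  have key : (-1 : ℂ) ^ (m - a + (n - b)) = (-1) ^ (m + n) * (-1) ^ (a + b) := by
    have e : m + n + (a + b) = (m - a + (n - b)) + 2 * (a + b) := by omega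
    rw [← pow_add, e, pow_add _ (m - a + (n - b)) (2 * (a + b)), pow_mul]
    simp
  rw [key]
  ring
end
end

section
/- Hermiticity of the symmetric product (Theorem 2, part 3): for all φ ∈ S_{i,j} and ω ∈ S_{k,l} and all integers m,n with 0 ≤ m ≤ min(i,k) and 0 ≤ n ≤ min(j,l), one has conj(φ ⊙_{m,n} ω) = conj(φ) ⊙_{n,m} conj(ω), where conj : S_{k,l} → S_{l,k} applies complex conjugation to all coefficients of a polynomial and then swaps the variable pairs (x,y) and (u,v). -/
open MvPolynomial Finset

noncomputable section

/-- Conjugation `conj : S_{k,l} → S_{l,k}`: complex-conjugate all coefficients and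
swap the variable pairs `(x,y) ↔ (u,v)`. -/
def conjS (P : MvPolynomial (Fin 4) ℂ) : MvPolynomial (Fin 4) ℂ :=
  rename (![2, 3, 0, 1] : Fin 4 → Fin 4) (MvPolynomial.map (starRingEnd ℂ) P)

lemma pderiv_comm' (p q : Fin 4) (P : MvPolynomial (Fin 4) ℂ) :
    pderiv p (pderiv q P) = pderiv q (pderiv p P) := by
  have h : ⁅(pderiv p : Derivation ℂ (MvPolynomial (Fin 4) ℂ) (MvPolynomial (Fin 4) ℂ)),
      (pderiv q : Derivation ℂ (MvPolynomial (Fin 4) ℂ) (MvPolynomial (Fin 4) ℂ))⁆ = 0 := by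
    apply MvPolynomial.derivation_ext
    intro r
    rw [Derivation.commutator_apply, pderiv_X, pderiv_X]
    simp only [Pi.single_apply]
    split_ifs <;> simp
  have h2 := congrArg (fun D => D P) h
  simp only [Derivation.commutator_apply, Derivation.zero_apply] at h2
  exact sub_eq_zero.mp h2

/-- Conjugation as a ring homomorphism. -/
def conjHom : MvPolynomial (Fin 4) ℂ →+* MvPolynomial (Fin 4) ℂ :=
  (rename (![2, 3, 0, 1] : Fin 4 → Fin 4) :
    MvPolynomial (Fin 4) ℂ →ₐ[ℂ] MvPolynomial (Fin 4) ℂ).toRingHom.comp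
      (MvPolynomial.map (starRingEnd ℂ))

lemma conjS_eq (P : MvPolynomial (Fin 4) ℂ) : conjS P = conjHom P := rfl

lemma conjS_smul (c : ℂ) (P : MvPolynomial (Fin 4) ℂ) :
    conjHom (c • P) = (starRingEnd ℂ c) • conjHom P := by
  simp [← conjS_eq, conjS, MvPolynomial.smul_eq_C_mul]

lemma conj_pderiv (p : Fin 4) (P : MvPolynomial (Fin 4) ℂ) :
    conjHom (pderiv p P) = pderiv ((![2, 3, 0, 1] : Fin 4 → Fin 4) p) (conjHom P) := by
  have hinj : Function.Injective (![2, 3, 0, 1] : Fin 4 → Fin 4) := by decide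
  rw [← conjS_eq, ← conjS_eq, conjS, conjS, pderiv_rename hinj, pderiv_map]

lemma conj_iter (p q : Fin 4) (h : (![2, 3, 0, 1] : Fin 4 → Fin 4) p = q) (a : ℕ)
    (P : MvPolynomial (Fin 4) ℂ) :
    conjHom ((fun Q => pderiv p Q)^[a] P) = (fun Q => pderiv q Q)^[a] (conjHom P) := by
  subst h
  exact (Function.Semiconj.iterate_right (f := conjHom) (fun P => conj_pderiv p P) a) P

lemma iter_comm (p q : Fin 4) (a b : ℕ) (P : MvPolynomial (Fin 4) ℂ) :
    (fun Q => pderiv p Q)^[a] ((fun Q => pderiv q Q)^[b] P) =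
      (fun Q => pderiv q Q)^[b] ((fun Q => pderiv p Q)^[a] P) :=
  (Function.Commute.iterate_iterate (f := fun Q : MvPolynomial (Fin 4) ℂ => pderiv p Q)
    (g := fun Q => pderiv q Q) (fun P => pderiv_comm' p q P) a b) P

lemma conj_Dop (a b c d : ℕ) (P : MvPolynomial (Fin 4) ℂ) :
    conjHom (Dop a b c d P) = Dop c d a b (conjHom P) := by
  unfold Dop
  rw [conj_iter 0 2 rfl, conj_iter 1 3 rfl, conj_iter 2 0 rfl, conj_iter 3 1 rfl,
    iter_comm 3 0, iter_comm 2 0, iter_comm 3 1, iter_comm 2 1]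

/-- Theorem 2, part 3: Hermiticity of the symmetric product. -/
theorem stmt2 (i j k l m n : ℕ) (φ ω : MvPolynomial (Fin 4) ℂ)
    (hφ : SS i j φ) (hω : SS k l ω)
    (hm : m ≤ min i k) (hn : n ≤ min j l) :
    conjS (symProd i j k l (m : ℤ) (n : ℤ) φ ω) =
      symProd j i l k (n : ℤ) (m : ℤ) (conjS φ) (conjS ω) := by
  have hm1 := le_min_iff.mp hm
  have hn1 := le_min_iff.mp hn
  unfold symProd
  rw [if_pos (by simp; omega), if_pos (by simp; omega)]
  simp only [conjS_eq, conjS_smul, map_sum, map_mul, conj_Dop, Int.toNat_natCast]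
  rw [Finset.sum_comm]
  congr 1
  · simp only [map_div₀, map_natCast]
    congr 2 <;> ring
  · refine Finset.sum_congr rfl fun b _ => Finset.sum_congr rfl fun a _ => ?_
    congr 1
    simp only [map_pow, map_neg, map_one, map_natCast]
    ring
end
end

section
/- Commutation relation for iterated symmetric products (Corollary 3): for all φ ∈ S_{i,j}, ω ∈ S_{r,s}, ϕ ∈ S_{k,l} and integers m,n,t,u with 0 ≤ m ≤ min(r,k), 0 ≤ n ≤ min(s,l), 0 ≤ t ≤ min(i, r+k−2m), 0 ≤ u ≤ min(j, s+l−2n), one has φ ⊙_{t,u} (ω ⊙_{m,n} ϕ) = Σ_{M=0}^{min(i,k)} Σ_{N=0}^{min(j,l)} F_{i,r,k}^{t,m,M} · F_{j,s,l}^{u,n,N} · ω ⊙_{t+m−M, u+n−N} (φ ⊙_{M,N} ϕ). -/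
open MvPolynomial Finset

noncomputable section

/-- Binomial coefficient on integers with the convention `C(a,b) = 0` if `b < 0` or `b > a`. -/
def Cz (a b : ℤ) : ℚ := if 0 ≤ b ∧ b ≤ a then (a.toNat.choose b.toNat : ℚ) else 0

/-- The `(p,q)`-summand of the associativity coefficient `F_{i,r,k}^{t,m,M}`. -/
def Fsummand (i r k t m M p q : ℕ) : ℚ :=
  (-1 : ℚ) ^ ((t : ℤ) - p + q) *
      Cz ((k : ℤ) - m) p * Cz (m : ℤ) ((M : ℤ) - p - q) * Cz ((k : ℤ) - m - p) q *
      Cz ((r : ℤ) - m) ((t : ℤ) - p) * Cz ((i : ℤ) - t) ((M : ℤ) - p - q) *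
      Cz ((t : ℤ) - p) q /
    (Cz ((i : ℤ) + k - M - p + 1) ((M : ℤ) - p) * Cz ((M : ℤ) - p) q *
      Cz ((k : ℤ) - 2 * m + r) t)

/-- The associativity coefficient `F_{i,r,k}^{t,m,M}`. -/
def Fcoef (i r k t m M : ℕ) : ℚ :=
  ∑ p ∈ Finset.range (M + 1), ∑ q ∈ Finset.range (M - p + 1), Fsummand i r k t m M p q



/-- single sum part of the Clebsch-Gordan coefficient -/
def GG (i k t m M : ℕ) : ℂ :=
  ∑ q ∈ range (M + 1), (-1 : ℂ) ^ q * (m.choose (M - q)) * ((k - m).choose q) *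
    ((i - t).choose (M - q)) * (t.choose q) / (M.choose q)

lemma absorb (t q : ℕ) : (t : ℂ) * ((t - 1).choose q : ℂ) = ((t : ℂ) - q) * (t.choose q : ℂ) := by
  rcases t with _ | t
  · rcases q with _ | q <;> simp
  · simp only [Nat.add_sub_cancel]
    by_cases h : q ≤ t + 1
    · have := Nat.add_one_mul_choose_eq t q
      have h2 := Nat.choose_mul_succ_eq t q
      have h3 : ((t + 1 - q : ℕ) : ℂ) = ((t + 1 : ℕ) : ℂ) - q := by rw [Nat.cast_sub h]
      rw [← h3]
      have h4 : ((t.choose q * (t+1) : ℕ) : ℂ) = (((t+1).choose q * (t + 1 - q) : ℕ) : ℂ) := by rw [h2]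
      push_cast at h4 ⊢
      linear_combination h4
    · rw [Nat.choose_eq_zero_of_lt (by omega), Nat.choose_eq_zero_of_lt (by omega)]; simp

lemma absorb2 (t q : ℕ) : ((q : ℂ) + 1) * (t.choose (q + 1) : ℂ) = ((t : ℂ) - q) * (t.choose q : ℂ) := by
  by_cases h : q ≤ t
  · have h2 := Nat.choose_succ_right_eq t q
    have h4 : ((t.choose (q + 1) * (q+1) : ℕ) : ℂ) = ((t.choose q * (t - q) : ℕ) : ℂ) := by rw [h2]
    push_cast [Nat.cast_sub h] at h4 
    linear_combination h4
  · rw [Nat.choose_eq_zero_of_lt (by omega), Nat.choose_eq_zero_of_lt (by omega)]; simp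

lemma GG_rec (i k t m M : ℕ) (ht : t ≤ i) (hm : m ≤ k) :
    (t : ℂ) * GG i k (t - 1) m M + (m : ℂ) * GG i k t (m - 1) M =
      ((t : ℂ) + m - M) * GG i k t m M := by
  -- b1, b2 : remainders
  set a : ℕ → ℂ := fun q => (-1 : ℂ) ^ q * (m.choose (M - q)) * ((k - m).choose q) *
    ((i - t).choose (M - q)) * (t.choose q) / (M.choose q) with ha
  set b1 : ℕ → ℂ := fun q => if q < M then (-1 : ℂ) ^ q * (m.choose (M - q)) * ((k - m).choose q) *
    ((i - t).choose (M - q - 1)) * (((t : ℂ) - q) * t.choose q) / (M.choose q) else 0 with hb1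
  set b2 : ℕ → ℂ := fun q => if 0 < q then (-1 : ℂ) ^ q * (((m : ℂ) - (M - q : ℕ)) * m.choose (M - q)) *
    ((k - m).choose (q - 1)) *
    ((i - t).choose (M - q)) * (t.choose q) / (M.choose q) else 0 with hb2
  have h1 : (t : ℂ) * GG i k (t - 1) m M = ∑ q ∈ range (M + 1), (((t : ℂ) - q) * a q + b1 q) := by
    rw [GG, mul_sum]
    refine sum_congr rfl fun q hq => ?_
    rcases t with _ | t
    · rcases q with _ | q
      · simp [hb1]
      · simp [hb1, ha]
    have e : i - (t + 1 - 1) = (i - (t + 1)) + 1 := by omega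
    have A := absorb (t + 1) q
    rw [e]
    simp only [ha, hb1]
    split_ifs with h
    · obtain ⟨d, hd⟩ : ∃ d, M - q = d + 1 := ⟨M - q - 1, by omega⟩
      rw [hd, Nat.choose_succ_succ]
      simp only [Nat.succ_eq_add_one, Nat.add_sub_cancel] at *
      push_cast at A ⊢
      linear_combination (-1 : ℂ) ^ q * (m.choose (d + 1)) * ((k - m).choose q) *
        (((i - (t+1)).choose d : ℂ) + (i - (t+1)).choose (d + 1)) / (M.choose q) * A
    · have hd : M - q = 0 := by omega
      rw [hd]
      simp only [Nat.add_sub_cancel, Nat.choose_zero_right] at *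
      linear_combination (-1 : ℂ) ^ q *  ((k - m).choose q) / (M.choose q) * A
  have h2 : (m : ℂ) * GG i k t (m - 1) M =
      ∑ q ∈ range (M + 1), (((m : ℂ) - (M - q : ℕ)) * a q + b2 q) := by
    rw [GG, mul_sum]
    refine sum_congr rfl fun q hq => ?_
    have A := absorb m (M - q)
    rcases m with _ | m
    · simp only [hb2, ha]
      generalize M - q = d at *
      rcases d with _ | d <;> simp
    have e : k - (m + 1 - 1) = (k - (m + 1)) + 1 := by omega
    rw [e]
    simp only [ha, hb2]
    split_ifs with h
    · obtain ⟨d, hd⟩ : ∃ d, q = d + 1 := ⟨q - 1, by omega⟩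
      rw [hd, Nat.choose_succ_succ]
      rw [hd] at A
      simp only [Nat.succ_eq_add_one, Nat.add_sub_cancel] at *
      push_cast at A ⊢
      linear_combination (-1 : ℂ) ^ (d + 1) * (t.choose (d + 1)) * ((i - t).choose (M - (d + 1))) *
        (((k - (m+1)).choose d : ℂ) + (k - (m+1)).choose (d + 1)) / (M.choose (d + 1)) * A
    · have hd : q = 0 := by omega
      rw [hd] at A ⊢
      simp only [Nat.add_sub_cancel, Nat.choose_zero_right] at *
      linear_combination (-1 : ℂ) ^ 0 * ((i - t).choose (M - 0)) / (1 : ℕ)  * A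
  have h3 : ∑ q ∈ range (M + 1), b1 q = ∑ q ∈ range M, b1 q := by
    rw [sum_range_succ]; simp [hb1]
  have h4 : ∑ q ∈ range (M + 1), b2 q = ∑ q ∈ range M, b2 (q + 1) := by
    rw [sum_range_succ']; simp [hb2]
  have h5 : ∑ q ∈ range M, b1 q + ∑ q ∈ range M, b2 (q + 1) = 0 := by
    rw [← sum_add_distrib]
    refine sum_eq_zero fun q hq => ?_
    have hq' : q < M := by simpa using hq
    simp only [hb1, hb2, hq', if_true, Nat.succ_pos]
    obtain ⟨d, rfl⟩ : ∃ d, M = q + d + 1 := ⟨M - q - 1, by omega⟩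
    have e1 : q + d + 1 - q - 1 = d := by omega
    have e2 : q + d + 1 - q = d + 1 := by omega
    have e3 : q + d + 1 - (q + 1) = d := by omega
    simp only [e2, e3, Nat.add_sub_cancel]
    have A1 := absorb2 m d
    have A2 := absorb2 t q
    have A3 := absorb2 (q + d + 1) q
    have n1 : (((q + d + 1).choose q : ℕ) : ℂ) ≠ 0 := by
      exact_mod_cast (Nat.choose_pos (by omega)).ne'
    have n2 : (((q + d + 1).choose (q + 1) : ℕ) : ℂ) ≠ 0 := by
      exact_mod_cast (Nat.choose_pos (by omega)).ne'
    have n3 : (q : ℂ) + 1 ≠ 0 := by exact_mod_cast Nat.succ_ne_zero q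
    rw [← A1, ← A2]
    have A3' : (((q : ℂ) + 1) * (q + d + 1).choose (q + 1)) = ((d : ℂ) + 1) * ((q + d + 1).choose q) := by
      rw [A3]; push_cast; ring
    rw [pow_succ]
    field_simp
    linear_combination (-1 : ℂ) ^ q * ((m.choose (d+1) : ℂ) * (k - m).choose q * (i - t).choose d * t.choose (q + 1)) * A3'
  rw [h1, h2, sum_add_distrib, sum_add_distrib, h3, h4]
  have h6 : ((t : ℂ) + m - M) * GG i k t m M = ∑ q ∈ range (M + 1), ((t : ℂ) - q) * a q +
     ∑ q ∈ range (M + 1), ((m : ℂ) - (M - q : ℕ)) * a q := by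
    rw [GG, mul_sum, ← sum_add_distrib]
    refine sum_congr rfl fun q hq => ?_
    have : q ≤ M := by simp at hq; omega
    rw [Nat.cast_sub this]; simp only [ha]; ring
  rw [h6]
  linear_combination h5

lemma GG_zero (i k t m M : ℕ) (h : t + m < M) : GG i k t m M = 0 := by
  refine sum_eq_zero fun q hq => ?_
  by_cases h1 : t < q
  · simp [Nat.choose_eq_zero_of_lt h1]
  · simp [Nat.choose_eq_zero_of_lt (show m < M - q by omega)]

lemma GG_zero2 (i k t m M : ℕ) (ht : t ≤ i) (hm : m ≤ k) (h : i + k < t + m + M) :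
    GG i k t m M = 0 := by
  refine sum_eq_zero fun q hq => ?_
  by_cases h1 : k - m < q
  · simp [Nat.choose_eq_zero_of_lt h1]
  · simp [Nat.choose_eq_zero_of_lt (show i - t < M - q by omega)]

lemma GG_top (i k t m : ℕ) :
    GG i k t m (t + m) = (-1) ^ t * ((k - m).choose t) * ((i - t).choose m) / ((t + m).choose t) := by
  rw [GG, sum_eq_single t]
  · simp
  · intro q hq hqt
    simp at hq
    rcases lt_or_gt_of_ne hqt with h | h
    · simp [Nat.choose_eq_zero_of_lt (show m < t + m - q by omega)]
    · simp [Nat.choose_eq_zero_of_lt h]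
  · intro h; simp at h

/-- The homogeneous Hahn type polynomial. -/
def Pp {R : Type*} [CommRing R] (i k T : ℕ) (U V : R) : R :=
  ∑ s ∈ range (T + 1), ((i.choose s * k.choose (T - s) : ℕ) : R) * ((-U) ^ s * V ^ (T - s))

lemma Pp_zero {R : Type*} [CommRing R] (i k T : ℕ) (U V : R) (h : i + k < T) : Pp i k T U V = 0 := by
  refine sum_eq_zero fun s hs => ?_
  by_cases h1 : i < s
  · simp [Nat.choose_eq_zero_of_lt h1]
  · simp [Nat.choose_eq_zero_of_lt (show k < T - s by omega)]

lemma Pp_map {R S : Type*} [CommRing R] [CommRing S] (f : R →+* S) (i k T : ℕ) (U V : R) :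
    f (Pp i k T U V) = Pp i k T (f U) (f V) := by
  simp [Pp, map_sum]

lemma Pp_hom {R : Type*} [CommRing R] (i k T : ℕ) (U V w : R) :
    Pp i k T (w * U) (w * V) = w ^ T * Pp i k T U V := by
  simp only [Pp, mul_sum]
  refine sum_congr rfl fun s hs => ?_
  have : T = s + (T - s) := by simp at hs; omega
  rw [neg_mul_eq_mul_neg, mul_pow, mul_pow]
  nth_rw 4 [this]
  rw [pow_add]; ring

/-- the full coefficient -/
def cc (i k t m M : ℕ) : ℂ :=
  (-1) ^ t * GG i k t m M / ((i + k - M + 1).choose M * (i + k - 2 * M).choose (t + m - M))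

lemma Pp_deriv (i k T : ℕ) :
    Polynomial.derivative (Pp i k (T + 1) (Polynomial.X : Polynomial ℂ) (1 - Polynomial.X)) =
      Polynomial.C (-((i : ℂ) + k - T)) * Pp i k T (Polynomial.X : Polynomial ℂ) (1 - Polynomial.X) := by
  set Z : Polynomial ℂ := Polynomial.X
  have e : ∀ s ∈ range (T + 1 + 1), Polynomial.derivative
      (((i.choose s * k.choose (T + 1 - s) : ℕ) : Polynomial ℂ) * ((-Z) ^ s * (1 - Z) ^ (T + 1 - s)))
      = -((i.choose s * k.choose (T + 1 - s) * s : ℕ) : Polynomial ℂ) * ((-Z) ^ (s - 1) * (1 - Z) ^ (T + 1 - s))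
      - ((i.choose s * k.choose (T + 1 - s) * (T + 1 - s) : ℕ) : Polynomial ℂ) * ((-Z) ^ s * (1 - Z) ^ (T + 1 - s - 1)) := by
    intro s hs
    simp only [Polynomial.derivative_mul, Polynomial.derivative_natCast, Polynomial.derivative_pow,
      Polynomial.derivative_neg, Polynomial.derivative_sub, Polynomial.derivative_one,
      Polynomial.derivative_X, Z, map_natCast]
    push_cast
    ring
  rw [Pp, Polynomial.derivative_sum, sum_congr rfl e, sum_sub_distrib, sum_range_succ']
  rw [sum_range_succ _ (T + 1), Pp, mul_sum]
  simp only [Nat.sub_self, mul_zero, Nat.cast_zero, neg_zero, zero_mul, add_zero]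
  rw [← sum_sub_distrib]
  refine sum_congr rfl fun s hs => ?_
  have hs' : s ≤ T := by simp at hs; omega
  obtain ⟨d, rfl⟩ : ∃ d, T = s + d := ⟨T - s, by omega⟩
  have e1 : s + d + 1 - (s + 1) = d := by omega
  have e2 : s + d + 1 - s = d + 1 := by omega
  have e3 : s + d - s = d := by omega
  simp only [e1, e2, e3, Nat.add_sub_cancel]
  have A1 := absorb2 i s
  have A2 := absorb2 k d
  have A3 : -(((i.choose (s + 1) * k.choose d * (s + 1) : ℕ)) : ℂ) - ((i.choose s * k.choose (d + 1) * (d + 1) : ℕ) : ℂ)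
     = -((i : ℂ) + k - (s + d : ℕ)) * ((i.choose s * k.choose d : ℕ) : ℂ) := by
    push_cast
    linear_combination - (k.choose d : ℂ) * A1 - (i.choose s : ℂ) * A2
  have A4 := congrArg (Polynomial.C) A3
  simp only [map_sub, map_neg, map_mul, map_natCast] at A4
  simp only [map_sub, map_neg, map_mul, map_natCast]
  linear_combination ((-Z) ^ s * (1 - Z) ^ d) * A4

/-- formal integral from 0 to 1 -/
def JJ : Polynomial ℂ →ₗ[ℂ] ℂ := Polynomial.lsum (fun n => (1 / ((n : ℂ) + 1)) • LinearMap.id)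

lemma JJ_deriv (p : Polynomial ℂ) : JJ (Polynomial.derivative p) = p.eval 1 - p.eval 0 := by
  induction p using Polynomial.induction_on' with
  | add p q hp hq => simp only [map_add, hp, hq, Polynomial.eval_add]; ring
  | monomial n a =>
    rw [Polynomial.derivative_monomial]
    rcases n with _ | n
    · simp
    · have : (n : ℂ) + 1 ≠ 0 := by exact_mod_cast Nat.succ_ne_zero n
      simp [JJ, Polynomial.lsum_apply, Polynomial.sum_monomial_index]
      field_simp

lemma JJ_beta (l : ℕ) : ∀ n : ℕ, JJ (Polynomial.X ^ n * (1 - Polynomial.X) ^ l) =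
    (n.factorial * l.factorial : ℂ) / (n + l + 1).factorial := by
  induction l with
  | zero =>
    intro n
    have : (n : ℂ) + 1 ≠ 0 := by exact_mod_cast Nat.succ_ne_zero n
    have h2 : (n.factorial : ℂ) ≠ 0 := by exact_mod_cast Nat.factorial_ne_zero n
    simp only [pow_zero, mul_one, Polynomial.X_pow_eq_monomial]
    simp [JJ, Polynomial.lsum_apply, Polynomial.sum_monomial_index, Nat.factorial_succ]
    field_simp
  | succ l ih =>
    intro n
    have h := JJ_deriv (Polynomial.X ^ (n + 1) * (1 - Polynomial.X) ^ (l + 1))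
    have e : Polynomial.derivative ((Polynomial.X : Polynomial ℂ) ^ (n + 1) * (1 - Polynomial.X) ^ (l + 1)) =
      ((n : ℂ) + 1) • (Polynomial.X ^ n * (1 - Polynomial.X) ^ (l + 1)) -
      ((l : ℂ) + 1) • (Polynomial.X ^ (n + 1) * (1 - Polynomial.X) ^ l) := by
      simp only [Polynomial.derivative_mul, Polynomial.derivative_pow,
        Polynomial.derivative_sub, Polynomial.derivative_one, Polynomial.derivative_X,
        Polynomial.smul_eq_C_mul, map_add, map_natCast, map_one, Nat.add_sub_cancel]
      push_cast
      ring
    rw [e, map_sub, map_smul, map_smul, ih] at h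
    simp at h
    have h1 : (n : ℂ) + 1 ≠ 0 := by exact_mod_cast Nat.succ_ne_zero n
    have h3 : ((n + 1 + l + 1).factorial : ℂ) ≠ 0 := by exact_mod_cast Nat.factorial_ne_zero _
    apply mul_left_cancel₀ h1
    rw [sub_eq_zero] at h
    rw [h, show n + (l + 1) + 1 = n + 1 + l + 1 by ring, Nat.factorial_succ n, Nat.factorial_succ l]
    push_cast
    field_simp

lemma cc_rec (i k t m M : ℕ) (ht : t ≤ i) (hm : m ≤ k) (h : M < t + m) (hi : M ≤ i) (hk : M ≤ k) :
    cc i k t m M * (-(((i - M : ℕ) : ℂ) + (k - M : ℕ) - (t + m - M - 1 : ℕ))) =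
      t * cc i k (t - 1) m M - m * cc i k t (m - 1) M := by
  obtain ⟨S, hS⟩ : ∃ S, t + m - M = S + 1 := ⟨t + m - M - 1, by omega⟩
  obtain ⟨n, hn⟩ : ∃ n, i + k - 2 * M = n := ⟨_, rfl⟩
  have hnc : (((i - M : ℕ) : ℂ) + (k - M : ℕ)) = n := by
    rw [← Nat.cast_add]; congr 1; omega
  have hT : (t : ℂ) + m - M = S + 1 := by
    have : t + m = S + 1 + M := by omega
    have : ((t + m : ℕ) : ℂ) = ((S + 1 + M : ℕ) : ℂ) := by rw [this]
    push_cast at this; linear_combination this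
  have h1 : (t : ℂ) * cc i k (t - 1) m M =
      -((-1) ^ t * (t * GG i k (t - 1) m M)) / ((i + k - M + 1).choose M * n.choose S) := by
    rcases t with _ | t
    · simp
    · rw [cc, hn, show t + 1 - 1 + m - M = S by omega, Nat.add_sub_cancel, pow_succ]
      ring
  have h2 : (m : ℂ) * cc i k t (m - 1) M =
      ((-1) ^ t * (m * GG i k t (m - 1) M)) / ((i + k - M + 1).choose M * n.choose S) := by
    rcases m with _ | m
    · simp
    · rw [cc, hn, show t + (m + 1 - 1) - M = S by omega, Nat.add_sub_cancel]
      ring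
  have hr := GG_rec i k t m M ht hm
  rw [hT] at hr
  have h3 : (t : ℂ) * cc i k (t - 1) m M - (m : ℂ) * cc i k t (m - 1) M =
      -((-1) ^ t * ((S + 1) * GG i k t m M)) / ((i + k - M + 1).choose M * n.choose S) := by
    rw [h1, h2, ← hr]; ring
  rw [h3, hnc, cc, hS, hn, Nat.add_sub_cancel]
  by_cases hc : S + 1 ≤ n
  · have A := absorb2 n S
    have n1 : (n.choose S : ℂ) ≠ 0 := by exact_mod_cast (Nat.choose_pos (by omega)).ne'
    have n2 : (n.choose (S + 1) : ℂ) ≠ 0 := by exact_mod_cast (Nat.choose_pos (by omega)).ne'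
    have n3 : ((i + k - M + 1).choose M : ℂ) ≠ 0 := by exact_mod_cast (Nat.choose_pos (by omega)).ne'
    field_simp
    linear_combination GG i k t m M * A
  · rw [GG_zero2 i k t m M ht hm (by omega)]; simp

lemma Pp_T0 {R : Type*} [CommRing R] (i k : ℕ) (U V : R) : Pp i k 0 U V = 1 := by
  simp [Pp]

lemma Pp_at0 (i k T : ℕ) (h : k < T) : Pp i k T (0 : ℂ) 1 = 0 := by
  refine sum_eq_zero fun s hs => ?_
  rcases s with _ | s
  · simp [Nat.choose_eq_zero_of_lt h]
  · simp

lemma Pp_at1 (i k T : ℕ) (h : i < T) : Pp i k T (1 : ℂ) 0 = 0 := by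
  refine sum_eq_zero fun s hs => ?_
  simp only [mem_range] at hs
  by_cases hs' : s = T
  · simp [hs', Nat.choose_eq_zero_of_lt h]
  · rw [zero_pow (show T - s ≠ 0 by omega)]; simp

lemma fct (a b : ℕ) : (a + b).choose a * a.factorial * b.factorial = (a + b).factorial := by
  have := Nat.choose_mul_factorial_mul_factorial (show a ≤ a + b by omega)
  rwa [Nat.add_sub_cancel_left] at this

lemma JJ_Pp (a b T : ℕ) (hT : 0 < T) :
    JJ (Pp (a + T) (b + T) T (Polynomial.X : Polynomial ℂ) (1 - Polynomial.X) *
      (Polynomial.X ^ b * (1 - Polynomial.X) ^ a)) = 0 := by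
  have e : Pp (a + T) (b + T) T (Polynomial.X : Polynomial ℂ) (1 - Polynomial.X) *
      (Polynomial.X ^ b * (1 - Polynomial.X) ^ a) = ∑ s ∈ range (T + 1),
      ((-1 : ℂ) ^ s * ((a + T).choose s * (b + T).choose (T - s))) •
        (Polynomial.X ^ (b + s) * (1 - Polynomial.X) ^ (a + (T - s))) := by
    rw [Pp, sum_mul]
    refine sum_congr rfl fun s hs => ?_
    rw [Polynomial.smul_eq_C_mul, neg_pow, pow_add, pow_add]
    simp only [map_mul, map_pow, map_neg, map_one, map_natCast]
    push_cast
    ring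
  rw [e, map_sum]
  simp only [map_smul, JJ_beta]
  have h0 : ∑ s ∈ range (T + 1), (-1 : ℂ) ^ s * (T.choose s : ℂ) = 0 := by
    have := Int.alternating_sum_range_choose_of_ne hT.ne'
    exact_mod_cast congrArg (Int.cast : ℤ → ℂ) this
  have : ∀ s ∈ range (T + 1), ((-1 : ℂ) ^ s * ((a + T).choose s * (b + T).choose (T - s))) •
      (((b + s).factorial * (a + (T - s)).factorial : ℂ) / (b + s + (a + (T - s)) + 1).factorial) =
      ((a + T).factorial * (b + T).factorial / (T.factorial * (a + b + T + 1).factorial)) *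
      ((-1 : ℂ) ^ s * (T.choose s : ℂ)) := by
    intro s hs
    obtain ⟨d, rfl⟩ : ∃ d, T = s + d := ⟨T - s, by simp at hs; omega⟩
    have c1 := fct s d
    have c2 := fct s (a + d)
    have c3 := fct d (b + s)
    rw [show s + d - s = d by omega, show a + (s + d) = s + (a + d) by ring,
      show b + (s + d) = d + (b + s) by ring, show b + s + (a + d) + 1 = a + b + (s + d) + 1 by ring,
      ← c1, ← c2, ← c3, smul_eq_mul]
    have f := fun n : ℕ => (Nat.cast_ne_zero (R := ℂ)).2 (Nat.factorial_ne_zero n)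
    have f1 := f s
    have f2 := f d
    have f3 := f (a + b + (s + d) + 1)
    have f4 : ((s + d).choose s : ℂ) ≠ 0 := by exact_mod_cast (Nat.choose_pos (by omega)).ne'
    push_cast
    field_simp
  rw [sum_congr rfl this, ← mul_sum, h0, mul_zero]

lemma cc_top (i k t m : ℕ) (hi : t + m ≤ i) (hk : t + m ≤ k) :
    cc i k t m (t + m) * JJ (Polynomial.X ^ (k - (t + m)) * (1 - Polynomial.X) ^ (i - (t + m))) =
      JJ (Polynomial.X ^ (k - m) * (1 - Polynomial.X) ^ (i - t)) := by
  obtain ⟨a, rfl⟩ := Nat.exists_eq_add_of_le hi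
  obtain ⟨b, rfl⟩ := Nat.exists_eq_add_of_le hk
  rw [JJ_beta, JJ_beta, cc, GG_top]
  rw [show t + m + b - (t + m) = b by omega, show t + m + a - (t + m) = a by omega,
    show t + m + b - m = t + b by omega, show t + m + a - t = m + a by omega, Nat.sub_self,
    show t + m + a + (t + m + b) - (t + m) + 1 = (t + m) + (a + b + 1) by omega,
    show t + b + (m + a) + 1 = (t + m) + (a + b + 1) by omega,
    show b + a + 1 = a + b + 1 by omega]
  have c1 := fct t m
  have c2 := fct t b
  have c3 := fct m a
  have c4 := fct (t + m) (a + b + 1)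
  rw [← c4, ← c1, ← c2, ← c3]
  have f := fun n : ℕ => (Nat.cast_ne_zero (R := ℂ)).2 (Nat.factorial_ne_zero n)
  have f1 := f t
  have f2 := f m
  have f3 := f (a + b + 1)
  have f4 : ((t + m).choose t : ℂ) ≠ 0 := by exact_mod_cast (Nat.choose_pos (by omega)).ne'
  have f5 : ((t + m + (a + b + 1)).choose (t + m) : ℂ) ≠ 0 := by
    exact_mod_cast (Nat.choose_pos (by omega)).ne'
  have hs : ((-1 : ℂ) ^ t) * (-1) ^ t = 1 := by rw [← mul_pow]; simp
  push_cast [Nat.choose_zero_right]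
  field_simp
  linear_combination ((t + b).choose t : ℂ) * ((m + a).choose m) * b.factorial * a.factorial * hs

/-- the error term -/
def Err (i k t m : ℕ) : Polynomial ℂ := (Polynomial.X : Polynomial ℂ) ^ t * (1 - Polynomial.X) ^ m -
      ∑ M ∈ range (min i k + 1), Polynomial.C (cc i k t m M) *
        Pp (i - M) (k - M) (t + m - M) (Polynomial.X : Polynomial ℂ) (1 - Polynomial.X)

lemma Err_fin (i k t m : ℕ) (ht : t ≤ i) (hm : m ≤ k) (h : Polynomial.derivative (Err i k t m) = 0) :
    Err i k t m = 0 := by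
  obtain ⟨e, he⟩ : ∃ e, Err i k t m = Polynomial.C e :=
    ⟨_, Polynomial.eq_C_of_derivative_eq_zero h⟩
  rw [he]
  suffices e = 0 by rw [this]; simp
  by_cases hk : t + m ≤ k
  swap
  · have : (Err i k t m).eval 0 = e := by rw [he]; simp
    rw [← this, Err, Polynomial.eval_sub, Polynomial.eval_finsetSum, sum_eq_zero]
    · simp; omega
    · intro M hM
      simp only [mem_range] at hM
      rw [Polynomial.eval_mul, ← Polynomial.coe_evalRingHom, Pp_map (Polynomial.evalRingHom (0:ℂ))]
      simp only [Polynomial.coe_evalRingHom, Polynomial.eval_X, Polynomial.eval_sub, Polynomial.eval_one, sub_zero]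
      rw [Pp_at0 _ _ _ (by omega), mul_zero]
  by_cases hi : t + m ≤ i
  swap
  · have : (Err i k t m).eval 1 = e := by rw [he]; simp
    rw [← this, Err, Polynomial.eval_sub, Polynomial.eval_finsetSum, sum_eq_zero]
    · simp; omega
    · intro M hM
      simp only [mem_range] at hM
      rw [Polynomial.eval_mul, ← Polynomial.coe_evalRingHom, Pp_map (Polynomial.evalRingHom (1:ℂ))]
      simp only [Polynomial.coe_evalRingHom, Polynomial.eval_X, Polynomial.eval_sub, Polynomial.eval_one, sub_self]
      rw [Pp_at1 _ _ _ (by omega), mul_zero]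
  set w : Polynomial ℂ := Polynomial.X ^ (k - (t + m)) * (1 - Polynomial.X) ^ (i - (t + m)) with hw
  have h1 : JJ (Err i k t m * w) = e * JJ w := by
    rw [he, ← Polynomial.smul_eq_C_mul, map_smul, smul_eq_mul]
  have h2 : JJ w ≠ 0 := by
    rw [hw, JJ_beta]
    have f := fun n : ℕ => (Nat.cast_ne_zero (R := ℂ)).2 (Nat.factorial_ne_zero n)
    exact div_ne_zero (mul_ne_zero (f _) (f _)) (f _)
  have h3 : JJ (Err i k t m * w) = 0 := by
    rw [Err, sub_mul, sum_mul, map_sub, map_sum, sum_eq_single (t + m)]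
    · rw [Nat.sub_self, Pp_T0, mul_one, ← Polynomial.smul_eq_C_mul, map_smul, smul_eq_mul, hw,
        cc_top i k t m hi hk, sub_eq_zero]
      congr 1
      rw [show k - m = t + (k - (t + m)) by omega, show i - t = m + (i - (t + m)) by omega,
        pow_add, pow_add]
      ring
    · intro M hM hne
      rw [mul_assoc, ← Polynomial.smul_eq_C_mul, map_smul, smul_eq_mul]
      by_cases hMD : M < t + m
      · rw [hw, show i - M = (i - (t + m)) + (t + m - M) by omega,
          show k - M = (k - (t + m)) + (t + m - M) by omega, JJ_Pp _ _ _ (by omega), mul_zero]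
      · rw [cc, GG_zero _ _ _ _ _ (by omega)]; simp
    · intro hh; simp at hh; omega
  rw [h1] at h3
  exact (mul_eq_zero.1 h3).resolve_right h2

lemma Err_deriv (i k t m : ℕ) (ht : t ≤ i) (hm : m ≤ k) :
    Polynomial.derivative (Err i k t m) =
      Polynomial.C (t : ℂ) * Err i k (t - 1) m - Polynomial.C (m : ℂ) * Err i k t (m - 1) := by
  have hQ : Polynomial.derivative ((Polynomial.X : Polynomial ℂ) ^ t * (1 - Polynomial.X) ^ m) =
      Polynomial.C (t : ℂ) * (Polynomial.X ^ (t - 1) * (1 - Polynomial.X) ^ m)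
      - Polynomial.C (m : ℂ) * (Polynomial.X ^ t * (1 - Polynomial.X) ^ (m - 1)) := by
    simp only [Polynomial.derivative_mul, Polynomial.derivative_pow,
        Polynomial.derivative_sub, Polynomial.derivative_one, Polynomial.derivative_X]
    ring
  rw [Err, map_sub, hQ, Polynomial.derivative_sum, Err, Err, mul_sub, mul_sub, mul_sum, mul_sum]
  rw [sub_sub_sub_comm, ← sum_sub_distrib]
  congr 1
  refine sum_congr rfl fun M hM => ?_
  simp only [mem_range] at hM
  rw [Polynomial.derivative_C_mul]
  by_cases hMD : M < t + m
  · have hr := cc_rec i k t m M ht hm hMD (by omega) (by omega)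
    obtain ⟨S, hS⟩ : ∃ S, t + m - M = S + 1 := ⟨t + m - M - 1, by omega⟩
    rw [hS] at hr ⊢
    rw [Pp_deriv]
    rw [Nat.add_sub_cancel] at hr
    have h1 : Polynomial.C (t : ℂ) * (Polynomial.C (cc i k (t - 1) m M) *
        Pp (i - M) (k - M) (t - 1 + m - M) (Polynomial.X : Polynomial ℂ) (1 - Polynomial.X)) =
      Polynomial.C (t : ℂ) * (Polynomial.C (cc i k (t - 1) m M) *
        Pp (i - M) (k - M) S (Polynomial.X : Polynomial ℂ) (1 - Polynomial.X)) := by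
      rcases t with _ | t
      · simp
      · rw [show t + 1 - 1 + m - M = S by omega]
    have h2 : Polynomial.C (m : ℂ) * (Polynomial.C (cc i k t (m - 1) M) *
        Pp (i - M) (k - M) (t + (m - 1) - M) (Polynomial.X : Polynomial ℂ) (1 - Polynomial.X)) =
      Polynomial.C (m : ℂ) * (Polynomial.C (cc i k t (m - 1) M) *
        Pp (i - M) (k - M) S (Polynomial.X : Polynomial ℂ) (1 - Polynomial.X)) := by
      rcases m with _ | m
      · simp
      · rw [show t + (m + 1 - 1) - M = S by omega]
    rw [h1, h2, ← mul_assoc, ← Polynomial.C_mul, hr, map_sub, map_mul, map_mul]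
    ring
  · rw [show t + m - M = 0 by omega, Pp_T0]
    have h1 : Polynomial.C (t : ℂ) * (Polynomial.C (cc i k (t - 1) m M) *
        Pp (i - M) (k - M) (t - 1 + m - M) (Polynomial.X : Polynomial ℂ) (1 - Polynomial.X)) = 0 := by
      rcases t with _ | t
      · simp
      · rw [cc, GG_zero _ _ _ _ _ (by omega)]; simp
    have h2 : Polynomial.C (m : ℂ) * (Polynomial.C (cc i k t (m - 1) M) *
        Pp (i - M) (k - M) (t + (m - 1) - M) (Polynomial.X : Polynomial ℂ) (1 - Polynomial.X)) = 0 := by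
      rcases m with _ | m
      · simp
      · rw [cc, GG_zero _ _ _ _ _ (by omega)]; simp
    rw [h1, h2]; simp

lemma Err_zero (i k : ℕ) : ∀ D t m : ℕ, t + m = D → t ≤ i → m ≤ k → Err i k t m = 0 := by
  intro D
  induction D with
  | zero =>
    intro t m h ht hm
    apply Err_fin _ _ _ _ ht hm
    rw [Err_deriv _ _ _ _ ht hm, show t = 0 by omega, show m = 0 by omega]
    simp
  | succ D ih =>
    intro t m h ht hm
    apply Err_fin _ _ _ _ ht hm
    rw [Err_deriv _ _ _ _ ht hm]
    have h1 : Polynomial.C (t : ℂ) * Err i k (t - 1) m = 0 := by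
      rcases t with _ | t
      · simp
      · rw [ih _ _ (by omega) (by omega) hm, mul_zero]
    have h2 : Polynomial.C (m : ℂ) * Err i k t (m - 1) = 0 := by
      rcases m with _ | m
      · simp
      · rw [ih _ _ (by omega) ht (by omega), mul_zero]
    rw [h1, h2, sub_zero]

lemma core_eval (i k t m : ℕ) (ht : t ≤ i) (hm : m ≤ k) (z : ℂ) :
    z ^ t * (1 - z) ^ m = ∑ M ∈ range (min i k + 1), cc i k t m M *
        Pp (i - M) (k - M) (t + m - M) z (1 - z) := by
  have h := congrArg (Polynomial.evalRingHom z) (Err_zero i k _ t m rfl ht hm)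
  rw [Err, map_sub, map_zero, sub_eq_zero, map_sum] at h
  simp only [map_mul, Pp_map] at h
  simpa using h

lemma core_field (i k t m : ℕ) (ht : t ≤ i) (hm : m ≤ k) (u v : ℂ) (h : u + v ≠ 0) :
    u ^ t * v ^ m = ∑ M ∈ range (min i k + 1), cc i k t m M *
       ((u + v) ^ M * Pp (i - M) (k - M) (t + m - M) u v) := by
  have hz := core_eval i k t m ht hm (u / (u + v))
  have e1 : u = (u + v) * (u / (u + v)) := by field_simp
  have e2 : v = (u + v) * (1 - u / (u + v)) := by field_simp; ring
  set w := u + v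
  set z := u / w
  rw [e1, e2]
  simp only [Pp_hom]
  rw [mul_pow, mul_pow, mul_mul_mul_comm, hz, mul_sum]
  refine sum_congr rfl fun M hM => ?_
  by_cases hMD : M ≤ t + m
  · have : w ^ t * w ^ m = w ^ M * w ^ (t + m - M) := by
      rw [← pow_add, ← pow_add]; congr 1; omega
    rw [this]; ring
  · rw [cc, GG_zero _ _ _ _ _ (by omega)]; simp

theorem core {R : Type*} [CommRing R] [Algebra ℂ R] (i k t m : ℕ) (ht : t ≤ i) (hm : m ≤ k) (U V : R) :
    U ^ t * V ^ m = ∑ M ∈ range (min i k + 1), algebraMap ℂ R (cc i k t m M) *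
       ((U + V) ^ M * Pp (i - M) (k - M) (t + m - M) U V) := by
  have key : (X 0 + X 1 : MvPolynomial (Fin 2) ℂ) * ((X 0 : MvPolynomial (Fin 2) ℂ) ^ t * (X 1) ^ m) =
    (X 0 + X 1) * ∑ M ∈ range (min i k + 1), algebraMap ℂ (MvPolynomial (Fin 2) ℂ) (cc i k t m M) *
       ((X 0 + X 1) ^ M * Pp (i - M) (k - M) (t + m - M) (X 0 : MvPolynomial (Fin 2) ℂ) (X 1)) := by
    apply MvPolynomial.funext
    intro x
    simp only [map_mul, map_sum, map_add, map_pow, Pp_map, eval_X, MvPolynomial.algebraMap_eq, eval_C]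
    by_cases h : x 0 + x 1 = 0
    · rw [h]; simp
    · rw [core_field i k t m ht hm _ _ h]
  have hne : (X 0 + X 1 : MvPolynomial (Fin 2) ℂ) ≠ 0 := by
    intro h
    have := congrArg (MvPolynomial.eval (![1, 0] : Fin 2 → ℂ)) h
    simp at this
  have key2 := congrArg (MvPolynomial.aeval (![U, V] : Fin 2 → R)).toRingHom (mul_left_cancel₀ hne key)
  simp only [map_mul, map_sum, map_add, map_pow, Pp_map] at key2
  simpa using key2

lemma Cz_nat (a b : ℕ) : Cz (a : ℤ) (b : ℤ) = (a.choose b : ℚ) := by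
  unfold Cz
  split_ifs with h
  · simp
  · rw [Nat.choose_eq_zero_of_lt (by omega)]; simp

lemma Cz_neg (a b : ℤ) (h : b < 0) : Cz a b = 0 := by
  unfold Cz
  rw [if_neg (by omega)]

lemma Cz_big (a b : ℤ) (h : a < b) : Cz a b = 0 := by
  unfold Cz
  rw [if_neg (by omega)]

/-- coefficient of the `p`-term on the left hand side -/
def wt (r k t m p : ℕ) : ℂ := if p ≤ t then ((k - m).choose p : ℂ) * ((r - m).choose (t - p)) else 0

lemma Fcoef_eq (i r k t m M : ℕ) (hr : m ≤ r) (hk : m ≤ k) (ht : t ≤ i) (hMi : M ≤ i) (hMk : M ≤ k) :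
    ((Fcoef i r k t m M : ℚ) : ℂ) = 1 / ((r + k - 2 * m).choose t) *
      ∑ p ∈ range (M + 1), wt r k t m p * ((-1) ^ (t - p) * GG (i - p) (k - p) (t - p) m (M - p) /
        ((i + k - M - p + 1).choose (M - p))) := by
  rw [Fcoef, mul_sum, Rat.cast_sum]
  refine sum_congr rfl fun p hp => ?_
  simp only [mem_range] at hp
  rw [wt]
  split_ifs with h
  swap
  · rw [sum_eq_zero]
    · simp
    · intro q hq
      rw [Fsummand, Cz_neg ((r : ℤ) - m) _ (by omega)]
      simp
  by_cases h2 : p ≤ k - m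
  swap
  · rw [sum_eq_zero]
    · rw [Nat.choose_eq_zero_of_lt (show k - m < p by omega)]; simp
    · intro q hq
      rw [Fsummand, Cz_big ((k : ℤ) - m) _ (by omega)]
      simp
  rw [GG, Rat.cast_sum, mul_sum, sum_div, mul_sum, mul_sum]
  refine sum_congr rfl fun q hq => ?_
  simp only [mem_range] at hq
  rw [Fsummand]
  rw [show (k : ℤ) - m = ((k - m : ℕ) : ℤ) by omega,
    show ((k - m : ℕ) : ℤ) - p = ((k - m - p : ℕ) : ℤ) by omega,
    show (M : ℤ) - p - q = ((M - p - q : ℕ) : ℤ) by omega,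
    show (r : ℤ) - m = ((r - m : ℕ) : ℤ) by omega,
    show (t : ℤ) - p + q = ((t - p + q : ℕ) : ℤ) by omega,
    show (t : ℤ) - p = ((t - p : ℕ) : ℤ) by omega,
    show (i : ℤ) - t = ((i - t : ℕ) : ℤ) by omega,
    show (i : ℤ) + k - M - p + 1 = ((i + k - M - p + 1 : ℕ) : ℤ) by omega,
    show (M : ℤ) - p = ((M - p : ℕ) : ℤ) by omega,
    show (k : ℤ) - 2 * m + r = ((r + k - 2 * m : ℕ) : ℤ) by omega]
  simp only [Cz_nat, zpow_natCast]
  rw [show k - p - m = k - m - p by omega, show i - p - (t - p) = i - t by omega]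
  push_cast
  rw [pow_add]
  ring

/-- The iterated derivative of `B^p C^q`, divided by `T!`. -/
def HH {R : Type*} [CommRing R] [Algebra ℂ R] (p q T : ℕ) (β γ : ℂ) (B C : R) : R :=
  ∑ s ∈ range (T + 1), algebraMap ℂ R (p.choose s * q.choose (T - s) * β ^ s * γ ^ (T - s)) *
    (B ^ (p - s) * C ^ (q - (T - s)))

lemma HH_mul {R : Type*} [CommRing R] [Algebra ℂ R] (p q T : ℕ) (β γ : ℂ) (B C : R) :
    (B ^ T * C ^ T) * HH p q T β γ B C =
      B ^ p * C ^ q * Pp p q T (-(algebraMap ℂ R β * C)) (algebraMap ℂ R γ * B) := by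
  rw [HH, Pp, mul_sum, mul_sum]
  refine sum_congr rfl fun s hs => ?_
  simp only [mem_range] at hs
  by_cases h1 : p < s
  · simp [Nat.choose_eq_zero_of_lt h1]
  by_cases h2 : q < T - s
  · simp [Nat.choose_eq_zero_of_lt h2]
  have e1 : B ^ T * B ^ (p - s) = B ^ p * B ^ (T - s) := by
    rw [← pow_add, ← pow_add]; congr 1; omega
  have e2 : C ^ T * C ^ (q - (T - s)) = C ^ q * C ^ s := by
    rw [← pow_add, ← pow_add]; congr 1; omega
  rw [neg_neg, mul_pow, mul_pow]
  simp only [map_mul, map_pow, map_natCast]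
  push_cast
  calc _ = ((p.choose s : R) * (q.choose (T - s)) * algebraMap ℂ R β ^ s * algebraMap ℂ R γ ^ (T - s)) *
      ((B ^ T * B ^ (p - s)) * (C ^ T * C ^ (q - (T - s)))) := by ring
    _ = _ := by rw [e1, e2]; ring

/-- the coefficients of the expansion, in terms of `cc`. -/
lemma Fcoef_cc (i r k t m M : ℕ) (hr : m ≤ r) (hk : m ≤ k) (ht : t ≤ i) (hMi : M ≤ i) (hMk : M ≤ k) :
    ((Fcoef i r k t m M : ℚ) : ℂ) / ((i + k - 2 * M).choose (t + m - M)) =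
      1 / ((r + k - 2 * m).choose t) *
      ∑ p ∈ range (t + 1), if p ≤ M then wt r k t m p * cc (i - p) (k - p) (t - p) m (M - p) else 0 := by
  rw [Fcoef_eq i r k t m M hr hk ht hMi hMk, mul_div_assoc]
  congr 1
  rw [sum_div, ← sum_filter]
  have : ∑ p ∈ range (M + 1), wt r k t m p * ((-1) ^ (t - p) * GG (i - p) (k - p) (t - p) m (M - p) /
        ((i + k - M - p + 1).choose (M - p))) / ((i + k - 2 * M).choose (t + m - M)) =
     ∑ p ∈ range (M + 1) with p ≤ t, wt r k t m p * ((-1) ^ (t - p) * GG (i - p) (k - p) (t - p) m (M - p) /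
        ((i + k - M - p + 1).choose (M - p))) / ((i + k - 2 * M).choose (t + m - M)) := by
    rw [sum_filter]
    refine sum_congr rfl fun p hp => ?_
    split_ifs with h
    · rfl
    · simp [wt, h]
  rw [this]
  refine sum_congr ?_ fun p hp => ?_
  · ext p; simp; omega
  · simp only [mem_filter, mem_range] at hp
    rw [cc, show i - p + (k - p) - (M - p) + 1 = i + k - M - p + 1 by omega,
      show i - p + (k - p) - 2 * (M - p) = i + k - 2 * M by omega,
      show t - p + m - (M - p) = t + m - M by omega]
    rw [mul_div_assoc, div_div]

lemma Fcoef_zero1 (i r k t m M : ℕ) (hr : m ≤ r) (hk : m ≤ k) (ht : t ≤ i) (hMi : M ≤ i) (hMk : M ≤ k)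
    (h : t + m < M) : ((Fcoef i r k t m M : ℚ) : ℂ) = 0 := by
  rw [Fcoef_eq i r k t m M hr hk ht hMi hMk, sum_eq_zero, mul_zero]
  intro p hp
  rw [wt]
  split_ifs with h1
  · rw [GG_zero _ _ _ _ _ (by omega)]; simp
  · simp

lemma Fcoef_zero2 (i r k t m M : ℕ) (hr : m ≤ r) (hk : m ≤ k) (ht : t ≤ i) (hMi : M ≤ i) (hMk : M ≤ k)
    (h : r + M < t + m) : ((Fcoef i r k t m M : ℚ) : ℂ) = 0 := by
  rw [Fcoef_eq i r k t m M hr hk ht hMi hMk, sum_eq_zero, mul_zero]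
  intro p hp
  simp only [mem_range] at hp
  rw [wt, Nat.choose_eq_zero_of_lt (show r - m < t - p by omega)]
  simp

lemma shift_sum {R : Type*} [AddCommMonoid R] (K p : ℕ) (hp : p ≤ K) (f : ℕ → R) :
    (∑ M ∈ range (K + 1), if p ≤ M then f M else 0) = ∑ M ∈ range (K - p + 1), f (p + M) := by
  rw [← sum_filter]
  have : (range (K + 1)).filter (fun M => p ≤ M) = Finset.Ico p (K + 1) := by
    ext x; simp; omega
  rw [this, sum_Ico_eq_sum_range, show K + 1 - p = K - p + 1 by omega]

lemma expand {R : Type*} [CommRing R] [Algebra ℂ R] (i r k t m : ℕ) (hr : m ≤ r) (hk : m ≤ k)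
    (ht : t ≤ i) (U V : R) :
    algebraMap ℂ R (1 / ((r + k - 2 * m).choose t)) * (V ^ m * Pp (r - m) (k - m) t (-U) (U + V)) =
      ∑ M ∈ range (min i k + 1),
        algebraMap ℂ R (((Fcoef i r k t m M : ℚ) : ℂ) / ((i + k - 2 * M).choose (t + m - M))) *
          ((U + V) ^ M * Pp (i - M) (k - M) (t + m - M) U V) := by
  have e : ∀ M ∈ range (min i k + 1),
      algebraMap ℂ R (((Fcoef i r k t m M : ℚ) : ℂ) / ((i + k - 2 * M).choose (t + m - M))) *
          ((U + V) ^ M * Pp (i - M) (k - M) (t + m - M) U V) =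
      algebraMap ℂ R (1 / ((r + k - 2 * m).choose t)) * ∑ p ∈ range (t + 1), if p ≤ M then
        algebraMap ℂ R (wt r k t m p * cc (i - p) (k - p) (t - p) m (M - p)) *
        ((U + V) ^ M * Pp (i - M) (k - M) (t + m - M) U V) else 0 := by
    intro M hM
    simp only [mem_range] at hM
    rw [Fcoef_cc i r k t m M hr hk ht (by omega) (by omega), map_mul, mul_assoc, map_sum, sum_mul]
    congr 1
    refine sum_congr rfl fun p hp => ?_
    split_ifs <;> simp
  rw [sum_congr rfl e, ← mul_sum, sum_comm]
  congr 1
  rw [Pp, mul_sum, ← Finset.sum_flip]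
  refine sum_congr rfl fun p hp => ?_
  simp only [mem_range] at hp
  by_cases hpk : k - m < p
  · have : wt r k t m p = 0 := by simp [wt, Nat.choose_eq_zero_of_lt hpk]
    rw [this, show t - (t - p) = p by omega, Nat.choose_eq_zero_of_lt hpk]
    simp
  rw [shift_sum _ _ (by omega)]
  have hc := core (i - p) (k - p) (t - p) m (by omega) (by omega) U V
  have e2 : ∀ M ∈ range (min i k - p + 1),
      algebraMap ℂ R (wt r k t m p * cc (i - p) (k - p) (t - p) m (p + M - p)) *
        ((U + V) ^ (p + M) * Pp (i - (p + M)) (k - (p + M)) (t + m - (p + M)) U V) =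
      (algebraMap ℂ R (wt r k t m p) * (U + V) ^ p) *
        (algebraMap ℂ R (cc (i - p) (k - p) (t - p) m M) *
       ((U + V) ^ M * Pp (i - p - M) (k - p - M) (t - p + m - M) U V)) := by
    intro M hM
    rw [map_mul, pow_add, show p + M - p = M by omega, show i - (p + M) = i - p - M by omega,
      show k - (p + M) = k - p - M by omega, show t + m - (p + M) = t - p + m - M by omega]
    ring
  rw [sum_congr rfl e2, ← mul_sum, show min i k - p = min (i - p) (k - p) by omega, ← hc, wt,
    if_pos (by omega), neg_neg, show t - (t - p) = p by omega]
  push_cast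
  ring

/-- one-factor version of the commutation relation, on powers of linear forms -/
theorem oneFactor {R : Type*} [CommRing R] [IsDomain R] [Algebra ℂ R] (i r k t m : ℕ)
    (hr : m ≤ r) (hk : m ≤ k) (ht : t ≤ i) (a b c : ℂ) (A B C : R) (hA : A ≠ 0) (hB : B ≠ 0)
    (hC : C ≠ 0)
    (hs : algebraMap ℂ R (a - b) * C + algebraMap ℂ R (b - c) * A = algebraMap ℂ R (a - c) * B) :
    algebraMap ℂ R ((b - c) ^ m / ((r + k - 2 * m).choose t)) *
      (A ^ (i - t) * HH (r - m) (k - m) t (a - b) (a - c) B C) =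
    ∑ M ∈ range (min i k + 1),
      if M ≤ t + m ∧ t + m ≤ r + M ∧ t + m + M ≤ i + k then
        algebraMap ℂ R (((Fcoef i r k t m M : ℚ) : ℂ) * (a - c) ^ M /
          ((i + k - 2 * M).choose (t + m - M))) *
        (B ^ (r - (t + m - M)) * HH (i - M) (k - M) (t + m - M) (b - a) (b - c) A C)
      else 0 := by
  set U := algebraMap ℂ R (a - b) * C with hU
  set V := algebraMap ℂ R (b - c) * A with hV
  have hx := expand i r k t m hr hk ht U V
  have hne : A ^ (t + m) * B ^ (t + m) * C ^ (t + m) ≠ 0 :=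
    mul_ne_zero (mul_ne_zero (pow_ne_zero _ hA) (pow_ne_zero _ hB)) (pow_ne_zero _ hC)
  apply mul_left_cancel₀ hne
  have hL : (A ^ (t + m) * B ^ (t + m) * C ^ (t + m)) *
      (algebraMap ℂ R ((b - c) ^ m / ((r + k - 2 * m).choose t)) *
      (A ^ (i - t) * HH (r - m) (k - m) t (a - b) (a - c) B C)) =
      (A ^ i * B ^ r * C ^ k) * (algebraMap ℂ R (1 / ((r + k - 2 * m).choose t)) *
        (V ^ m * Pp (r - m) (k - m) t (-U) (U + V))) := by
    have h1 := HH_mul (r - m) (k - m) t (a - b) (a - c) B C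
    rw [← hs, ← hU] at h1
    have e1 : A ^ i = A ^ (i - t) * A ^ t := by rw [← pow_add]; congr 1; omega
    have e2 : B ^ r = B ^ (r - m) * B ^ m := by rw [← pow_add]; congr 1; omega
    have e3 : C ^ k = C ^ (k - m) * C ^ m := by rw [← pow_add]; congr 1; omega
    rw [e1, e2, e3, div_eq_mul_one_div, map_mul, map_pow, pow_add, pow_add, pow_add, hV, mul_pow]
    rw [← hV]
    linear_combination (algebraMap ℂ R (1 / ((r + k - 2 * m).choose t)) *
      algebraMap ℂ R (b - c) ^ m * A ^ (i - t) * A ^ t * A ^ m * B ^ m * C ^ m) * h1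
  rw [hL, hx, mul_sum, mul_sum]
  refine sum_congr rfl fun M hM => ?_
  simp only [mem_range] at hM
  split_ifs with h
  · have h1 := HH_mul (i - M) (k - M) (t + m - M) (b - a) (b - c) A C
    rw [← hV, show -(algebraMap ℂ R (b - a) * C) = U by rw [hU, ← neg_sub a b, map_neg]; ring] at h1
    have e1 : A ^ i = A ^ (i - M) * A ^ M := by rw [← pow_add]; congr 1; omega
    have e2 : B ^ r = B ^ (r - (t + m - M)) * B ^ (t + m - M) := by rw [← pow_add]; congr 1; omega
    have e3 : C ^ k = C ^ (k - M) * C ^ M := by rw [← pow_add]; congr 1; omega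
    have e4 : ∀ Y : R, Y ^ (t + m) = Y ^ (t + m - M) * Y ^ M := by
      intro Y; rw [← pow_add]; congr 1; omega
    rw [e1, e2, e3, e4, e4, e4, hs, mul_div_right_comm, map_mul, map_pow, mul_pow]
    linear_combination (-algebraMap ℂ R (((Fcoef i r k t m M : ℚ) : ℂ) /
          ((i + k - 2 * M).choose (t + m - M))) *
      algebraMap ℂ R (a - c) ^ M * B ^ (r - (t + m - M)) * B ^ (t + m - M) * B ^ M * A ^ M * C ^ M) * h1
  · by_cases c1 : t + m < M
    · rw [Fcoef_zero1 i r k t m M hr hk ht (by omega) (by omega) c1]; simp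
    by_cases c2 : r + M < t + m
    · rw [Fcoef_zero2 i r k t m M hr hk ht (by omega) (by omega) c2]; simp
    rw [Pp_zero _ _ _ _ _ (by omega)]; simp


/-- `ℂ[x,y,u,v]` -/
abbrev PP := MvPolynomial (Fin 4) ℂ

/-- partial derivative as an endomorphism -/
def pd (n : Fin 4) : Module.End ℂ PP := (pderiv n : Derivation ℂ PP PP).toLinearMap

lemma pd_apply (n : Fin 4) (f : PP) : pd n f = pderiv n f := rfl

lemma pd_comm (a b : Fin 4) : Commute (pd a) (pd b) := by
  have h : ⁅(pderiv a : Derivation ℂ PP PP), (pderiv b : Derivation ℂ PP PP)⁆ = 0 := by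
    apply MvPolynomial.derivation_ext
    intro n
    rw [Derivation.commutator_apply]
    simp only [pderiv_X, Pi.single_apply]
    split_ifs <;> simp
  apply LinearMap.ext
  intro f
  have := congrArg (fun D : Derivation ℂ PP PP => D f) h
  simp only [Derivation.commutator_apply, Derivation.zero_apply, sub_eq_zero] at this
  simpa [pd] using this

lemma Dop_eq (a b c d : ℕ) (P : PP) :
    Dop a b c d P = (pd 0 ^ a * pd 1 ^ b * pd 2 ^ c * pd 3 ^ d) P := by
  simp only [Module.End.mul_apply, Module.End.pow_apply]
  rfl

/-- `symProd` as a bilinear map -/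
lemma symProd_lin (i j k l : ℕ) (m n : ℤ) :
    ∃ L : PP →ₗ[ℂ] PP →ₗ[ℂ] PP, ∀ φ ψ, symProd i j k l m n φ ψ = L φ ψ := by
  by_cases h : 0 ≤ m ∧ m ≤ min (i : ℤ) (k : ℤ) ∧ 0 ≤ n ∧ n ≤ min (j : ℤ) (l : ℤ)
  · refine ⟨((((i - m.toNat).factorial * (k - m.toNat).factorial * (j - n.toNat).factorial *
        (l - n.toNat).factorial : ℕ) : ℂ) /
      (((i.factorial * k.factorial * j.factorial * l.factorial : ℕ)) : ℂ)) •
      ∑ a ∈ Finset.range (m.toNat + 1), ∑ b ∈ Finset.range (n.toNat + 1),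
      ((-1 : ℂ) ^ (a + b) * (m.toNat.choose a : ℂ) * (n.toNat.choose b : ℂ)) •
      (LinearMap.mul ℂ PP).compl₁₂ (pd 0 ^ a * pd 1 ^ (m.toNat - a) * pd 2 ^ b * pd 3 ^ (n.toNat - b))
        (pd 0 ^ (m.toNat - a) * pd 1 ^ a * pd 2 ^ (n.toNat - b) * pd 3 ^ b), ?_⟩
    intro φ ψ
    rw [symProd, if_pos h]
    simp only [LinearMap.smul_apply, LinearMap.sum_apply, LinearMap.compl₁₂_apply,
      LinearMap.mul_apply', Dop_eq]
  · exact ⟨0, fun φ ψ => by rw [symProd, if_neg h]; simp⟩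

/-- linear forms -/
def la (a : ℂ) : PP := X 0 + C a * X 1
/-- linear forms, second kind -/
def lb (a : ℂ) : PP := X 2 + C a * X 3

lemma vand {V : Type*} [AddCommGroup V] [Module ℂ V] (S : Submodule ℂ V) (n : ℕ) (v : ℕ → V)
    (h : ∀ c : ℂ, ∑ s ∈ range (n + 1), c ^ s • v s ∈ S) : ∀ s ≤ n, v s ∈ S := by
  intro s hs
  by_contra hv
  obtain ⟨f, hf, hS⟩ := Submodule.exists_le_ker_of_notMem hv
  apply hf
  have hp : (∑ s ∈ range (n + 1), Polynomial.C (f (v s)) * Polynomial.X ^ s : Polynomial ℂ) = 0 := by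
    apply Polynomial.funext
    intro c
    have := hS (h c)
    simp only [LinearMap.mem_ker, map_sum, map_smul, smul_eq_mul] at this
    rw [Polynomial.eval_finsetSum, Polynomial.eval_zero, ← this]
    refine sum_congr rfl fun x hx => ?_
    rw [Polynomial.eval_mul, Polynomial.eval_C, Polynomial.eval_pow, Polynomial.eval_X, mul_comm]
  have := congrArg (fun p => Polynomial.coeff p s) hp
  simp only [Polynomial.finsetSum_coeff, Polynomial.coeff_C_mul_X_pow, Polynomial.coeff_zero] at this
  rw [sum_ite_eq, if_pos (by simp; omega)] at this
  exact this

lemma lin_pow (x y : PP) (n : ℕ) (c : ℂ) : (x + C c * y) ^ n =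
    ∑ s ∈ range (n + 1), c ^ s • ((n.choose s : ℂ) • (x ^ (n - s) * y ^ s)) := by
  rw [add_comm, add_pow]
  refine sum_congr rfl fun s hs => ?_
  rw [smul_eq_C_mul, smul_eq_C_mul, mul_pow, map_pow, map_natCast]
  ring

lemma span_SS (i j : ℕ) (φ : PP) (h : SS i j φ) :
    φ ∈ Submodule.span ℂ (Set.range fun p : ℂ × ℂ => la p.1 ^ i * lb p.2 ^ j) := by
  set S := Submodule.span ℂ (Set.range fun p : ℂ × ℂ => la p.1 ^ i * lb p.2 ^ j) with hS
  have h1 : ∀ c' : ℂ, ∀ s ≤ i, (X 0 ^ (i - s) * X 1 ^ s : PP) * lb c' ^ j ∈ S := by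
    intro c' s hs
    have := vand S i (fun s => ((i.choose s : ℂ) • (X 0 ^ (i - s) * X 1 ^ s : PP)) * lb c' ^ j) ?_ s hs
    · simp only [smul_mul_assoc] at this
      exact (Submodule.smul_mem_iff _ (by exact_mod_cast (Nat.choose_pos hs).ne')).1 this
    · intro c
      have e := lin_pow (X 0) (X 1) i c
      have : la c ^ i * lb c' ^ j ∈ S := Submodule.subset_span ⟨(c, c'), rfl⟩
      rw [la, e, sum_mul] at this
      simpa only [smul_mul_assoc] using this
  have h2 : ∀ s ≤ i, ∀ s' ≤ j, (X 0 ^ (i - s) * X 1 ^ s : PP) * (X 2 ^ (j - s') * X 3 ^ s') ∈ S := by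
    intro s hs s' hs'
    have := vand S j (fun s' => (X 0 ^ (i - s) * X 1 ^ s : PP) *
      ((j.choose s' : ℂ) • (X 2 ^ (j - s') * X 3 ^ s' : PP))) ?_ s' hs'
    · simp only [mul_smul_comm] at this
      exact (Submodule.smul_mem_iff _ (by exact_mod_cast (Nat.choose_pos hs').ne')).1 this
    · intro c
      have e := lin_pow (X 2) (X 3) j c
      have := h1 c s hs
      rw [lb, e, mul_sum] at this
      simpa only [mul_smul_comm] using this
  rw [← MvPolynomial.support_sum_monomial_coeff φ]
  refine Submodule.sum_mem _ fun d hd => ?_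
  rw [mem_support_iff] at hd
  have hi := h.1 hd
  have hj := h.2 hd
  rw [Finsupp.weight_apply, Finsupp.sum_fintype _ _ (by simp)] at hi hj
  simp [Fin.sum_univ_four] at hi hj
  have := h2 (d 1) (by omega) (d 3) (by omega)
  have e : monomial d (coeff d φ) = (coeff d φ) • ((X 0 ^ (i - d 1) * X 1 ^ d 1 : PP) *
      (X 2 ^ (j - d 3) * X 3 ^ d 3)) := by
    rw [monomial_eq, smul_eq_C_mul, Finsupp.prod_fintype _ _ (by simp), Fin.prod_univ_four,
      show i - d 1 = d 0 by omega, show j - d 3 = d 2 by omega]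
    ring
  rw [e]
  exact Submodule.smul_mem _ _ this

lemma der_pow {δ : Derivation ℂ PP PP} {G B : PP} {β : ℂ} (hG : δ G = 0) (hB : δ B = C β) (j d : ℕ) :
    (δ.toLinearMap ^ d : Module.End ℂ PP) (G * B ^ j) =
      C ((j.descFactorial d : ℂ) * β ^ d) * (G * B ^ (j - d)) := by
  induction d with
  | zero => simp
  | succ d ih =>
    rw [pow_succ', Module.End.mul_apply, ih]
    simp only [Derivation.coeFn_coe, Derivation.leibniz, Derivation.leibniz_pow, hG, hB, smul_eq_mul,
      smul_zero, add_zero, nsmul_eq_mul, ← MvPolynomial.algebraMap_eq, Derivation.map_algebraMap]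
    rw [Nat.descFactorial_succ, show j - (d + 1) = j - d - 1 by omega]
    simp only [MvPolynomial.algebraMap_eq]
    push_cast
    simp only [map_mul, map_pow, map_natCast]
    ring

lemma der_HH1 {δ : Derivation ℂ PP PP} {B D : PP} {β γ : ℂ} (hB : δ B = C β) (hD : δ D = C γ)
    (p q T : ℕ) : δ (HH p q T β γ B D) = C ((T : ℂ) + 1) * HH p q (T + 1) β γ B D := by
  set f : ℕ → PP := fun s => C ((p.choose s * (s : ℂ)) * q.choose (T + 1 - s) * β ^ s * γ ^ (T + 1 - s)) *
    (B ^ (p - s) * D ^ (q - (T + 1 - s))) with hf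
  set g : ℕ → PP := fun s => C (p.choose s * (q.choose (T + 1 - s) * ((T + 1 - s : ℕ) : ℂ)) * β ^ s *
    γ ^ (T + 1 - s)) * (B ^ (p - s) * D ^ (q - (T + 1 - s))) with hg
  have h1 : C ((T : ℂ) + 1) * HH p q (T + 1) β γ B D = ∑ s ∈ range (T + 1 + 1), (f s + g s) := by
    rw [HH, mul_sum]
    refine sum_congr rfl fun s hs => ?_
    simp only [mem_range] at hs
    have : (T : ℂ) + 1 = s + (T + 1 - s : ℕ) := by
      rw [← Nat.cast_add, show s + (T + 1 - s) = T + 1 by omega]; push_cast; rfl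
    rw [this, hf, hg, MvPolynomial.algebraMap_eq, ← mul_assoc, ← map_mul, ← add_mul, ← map_add]
    congr 2
    ring
  have h2 : δ (HH p q T β γ B D) = ∑ s ∈ range (T + 1), (f (s + 1) + g s) := by
    rw [HH, map_sum]
    refine sum_congr rfl fun s hs => ?_
    simp only [mem_range] at hs
    obtain ⟨d, rfl⟩ : ∃ d, T = s + d := ⟨T - s, by omega⟩
    have A1 := absorb2 p s
    have A2 := absorb2 q d
    have B1 : (p.choose (s + 1) : ℂ) * ((s + 1 : ℕ) : ℂ) = (p.choose s) * ((p - s : ℕ) : ℂ) := by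
      exact_mod_cast Nat.choose_succ_right_eq p s
    have B2 : (q.choose (d + 1) : ℂ) * ((d + 1 : ℕ) : ℂ) = (q.choose d) * ((q - d : ℕ) : ℂ) := by
      exact_mod_cast Nat.choose_succ_right_eq q d
    simp only [hf, hg]
    rw [show s + d - s = d by omega, show s + d + 1 - (s + 1) = d by omega,
      show s + d + 1 - s = d + 1 by omega, B1, B2, show p - (s + 1) = p - s - 1 by omega,
      show q - (d + 1) = q - d - 1 by omega]
    simp only [Derivation.leibniz, Derivation.leibniz_pow, hB, hD, smul_eq_mul,
      smul_zero, add_zero, nsmul_eq_mul, Derivation.map_algebraMap]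
    simp only [MvPolynomial.algebraMap_eq, map_mul, map_pow, map_natCast]
    ring
  have f0 : f 0 = 0 := by simp [hf]
  have gT : g (T + 1) = 0 := by simp [hg]
  rw [h1, h2, sum_add_distrib, sum_add_distrib, sum_range_succ' f, sum_range_succ g (T + 1), f0, gT,
    add_zero, add_zero]

lemma der_HH {δ : Derivation ℂ PP PP} {G B D : PP} {β γ : ℂ} (hG : δ G = 0) (hB : δ B = C β)
    (hD : δ D = C γ) (p q T : ℕ) :
    (δ.toLinearMap ^ T : Module.End ℂ PP) (G * (B ^ p * D ^ q)) =
      C (T.factorial : ℂ) * (G * HH p q T β γ B D) := by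
  induction T with
  | zero => simp [HH]
  | succ T ih =>
    rw [pow_succ', Module.End.mul_apply, ih]
    simp only [Derivation.coeFn_coe, Derivation.leibniz, hG, der_HH1 hB hD, smul_eq_mul,
      smul_zero, add_zero, ← MvPolynomial.algebraMap_eq, Derivation.map_algebraMap]
    rw [Nat.factorial_succ]
    simp only [MvPolynomial.algebraMap_eq]
    push_cast
    simp only [map_mul, map_add, map_one, map_natCast]
    ring

/-- directional derivative -/
def Da (a : ℂ) : Derivation ℂ PP PP := a • pderiv 0 - pderiv 1
/-- directional derivative, second kind -/
def Db (a : ℂ) : Derivation ℂ PP PP := a • pderiv 2 - pderiv 3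

lemma Da_la (a b : ℂ) : Da a (la b) = C (a - b) := by
  simp [Da, la, pderiv_X, smul_eq_C_mul]
lemma Db_lb (a b : ℂ) : Db a (lb b) = C (a - b) := by
  simp [Db, lb, pderiv_X, smul_eq_C_mul]
lemma Da_lb (a b : ℂ) : Da a (lb b) = 0 := by
  simp [Da, lb, pderiv_X, smul_eq_C_mul]
lemma Db_la (a b : ℂ) : Db a (la b) = 0 := by
  simp [Db, la, pderiv_X, smul_eq_C_mul]

lemma Da_pow (a : ℂ) (m : ℕ) : ((Da a).toLinearMap ^ m : Module.End ℂ PP) =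
    ∑ s ∈ range (m + 1), ((-1 : ℂ) ^ s * m.choose s * a ^ (m - s)) • (pd 0 ^ (m - s) * pd 1 ^ s) := by
  have e : ((Da a).toLinearMap : Module.End ℂ PP) = (-1 : ℂ) • pd 1 + a • pd 0 := by
    apply LinearMap.ext; intro f
    simp [Da, pd]; ring
  have hc : Commute ((-1 : ℂ) • pd 1) (a • pd 0) := ((pd_comm 1 0).smul_left _).smul_right _
  rw [e, hc.add_pow]
  refine sum_congr rfl fun s hs => ?_
  rw [smul_pow, smul_pow, ← nsmul_eq_mul', smul_mul_smul_comm, ← Nat.cast_smul_eq_nsmul ℂ, smul_smul,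
    ((pd_comm 1 0).pow_pow _ _).eq]
  congr 1
  ring

lemma Db_pow (a : ℂ) (m : ℕ) : ((Db a).toLinearMap ^ m : Module.End ℂ PP) =
    ∑ s ∈ range (m + 1), ((-1 : ℂ) ^ s * m.choose s * a ^ (m - s)) • (pd 2 ^ (m - s) * pd 3 ^ s) := by
  have e : ((Db a).toLinearMap : Module.End ℂ PP) = (-1 : ℂ) • pd 3 + a • pd 2 := by
    apply LinearMap.ext; intro f
    simp [Db, pd]; ring
  have hc : Commute ((-1 : ℂ) • pd 3) (a • pd 2) := ((pd_comm 3 2).smul_left _).smul_right _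
  rw [e, hc.add_pow]
  refine sum_congr rfl fun s hs => ?_
  rw [smul_pow, smul_pow, ← nsmul_eq_mul', smul_mul_smul_comm, ← Nat.cast_smul_eq_nsmul ℂ, smul_smul,
    ((pd_comm 3 2).pow_pow _ _).eq]
  congr 1
  ring


lemma pd_la_aux (e : Fin 4) (β β' : ℂ) (a a' : ℂ) (h1 : pderiv e (la a) = C β)
    (h2 : pderiv e (lb a') = C β') (i j d : ℕ) (g : ℂ) :
    (β' = 0 → (pd e ^ d) (C g * (la a ^ i * lb a' ^ j)) =
      C (g * ((i.descFactorial d : ℂ) * β ^ d)) * (la a ^ (i - d) * lb a' ^ j)) ∧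
    (β = 0 → (pd e ^ d) (C g * (la a ^ i * lb a' ^ j)) =
      C (g * ((j.descFactorial d : ℂ) * β' ^ d)) * (la a ^ i * lb a' ^ (j - d))) := by
  constructor
  · rintro rfl
    have hG : (pderiv e : Derivation ℂ PP PP) (lb a' ^ j) = 0 := by
      rw [Derivation.leibniz_pow, h2]; simp
    have := der_pow hG h1 i d
    rw [← smul_eq_C_mul, map_smul, mul_comm (la a ^ i)]
    change g • ((pderiv e : Derivation ℂ PP PP).toLinearMap ^ d : Module.End ℂ PP) _ = _
    rw [this, smul_eq_C_mul, map_mul C g]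
    ring
  · rintro rfl
    have hG : (pderiv e : Derivation ℂ PP PP) (la a ^ i) = 0 := by
      rw [Derivation.leibniz_pow, h1]; simp
    have := der_pow hG h2 j d
    rw [← smul_eq_C_mul, map_smul]
    change g • ((pderiv e : Derivation ℂ PP PP).toLinearMap ^ d : Module.End ℂ PP) _ = _
    rw [this, smul_eq_C_mul, map_mul C g]
    ring

lemma desc_add (i q p : ℕ) : i.descFactorial (q + p) = i.descFactorial q * (i - q).descFactorial p := by
  induction p with
  | zero => simp
  | succ p ih =>
    rw [← add_assoc, Nat.descFactorial_succ, Nat.descFactorial_succ, ih, Nat.sub_sub]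
    ring

lemma Dop_la (i j p q p' q' : ℕ) (a a' : ℂ) : Dop p q p' q' (la a ^ i * lb a' ^ j) =
    C ((i.descFactorial (p + q) : ℂ) * (j.descFactorial (p' + q')) * a ^ q * a' ^ q') *
      (la a ^ (i - (p + q)) * lb a' ^ (j - (p' + q'))) := by
  have a0 : pderiv 0 (la a) = C 1 := by simp [la, pderiv_X]
  have a1 : pderiv 1 (la a) = C a := by simp [la, pderiv_X]
  have a2 : pderiv 2 (la a) = C 0 := by simp [la, pderiv_X]
  have a3 : pderiv 3 (la a) = C 0 := by simp [la, pderiv_X]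
  have b0 : pderiv 0 (lb a') = C 0 := by simp [lb, pderiv_X]
  have b1 : pderiv 1 (lb a') = C 0 := by simp [lb, pderiv_X]
  have b2 : pderiv 2 (lb a') = C 1 := by simp [lb, pderiv_X]
  have b3 : pderiv 3 (lb a') = C a' := by simp [lb, pderiv_X]
  rw [Dop_eq, ← one_mul (la a ^ i * lb a' ^ j), ← C_1]
  simp only [Module.End.mul_apply]
  rw [(pd_la_aux 3 _ _ a a' a3 b3 i j q' 1).2 rfl, (pd_la_aux 2 _ _ a a' a2 b2 i _ p' _).2 rfl,
    (pd_la_aux 1 _ _ a a' a1 b1 i _ q _).1 rfl, (pd_la_aux 0 _ _ a a' a0 b0 _ _ p _).1 rfl]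
  rw [add_comm p q, add_comm p' q', desc_add i q p,
    desc_add j q' p', Nat.sub_sub, Nat.sub_sub]
  congr 2
  push_cast
  ring

lemma symProd_la (i j k l m n : ℕ) (a a' : ℂ) (ψ : PP) (hm : m ≤ i) (hm' : m ≤ k) (hn : n ≤ j)
    (hn' : n ≤ l) : symProd i j k l m n (la a ^ i * lb a' ^ j) ψ =
    C (((k - m).factorial * (l - n).factorial : ℂ) / (k.factorial * l.factorial)) *
      (la a ^ (i - m) * lb a' ^ (j - n) *
        ((Da a).toLinearMap ^ m : Module.End ℂ PP) (((Db a').toLinearMap ^ n : Module.End ℂ PP) ψ)) := by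
  rw [symProd, if_pos (by omega)]
  simp only [Int.toNat_natCast]
  rw [Da_pow, Db_pow]
  simp only [LinearMap.sum_apply, map_sum, LinearMap.smul_apply, map_smul, mul_sum, smul_sum]
  rw [sum_comm]
  refine sum_congr rfl fun x hx => sum_congr rfl fun y hy => ?_
  simp only [mem_range] at hx hy
  rw [Dop_la, Dop_eq, show y + (m - y) = m by omega, show x + (n - x) = n by omega]
  simp only [Module.End.mul_apply, smul_eq_C_mul]
  have e1 : (i.descFactorial m : ℂ) * (i - m).factorial = i.factorial := by
    rw [mul_comm]; exact_mod_cast Nat.factorial_mul_descFactorial hm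
  have e2 : (j.descFactorial n : ℂ) * (j - n).factorial = j.factorial := by
    rw [mul_comm]; exact_mod_cast Nat.factorial_mul_descFactorial hn
  have n1 : (i.factorial : ℂ) ≠ 0 := by exact_mod_cast i.factorial_ne_zero
  have n2 : (j.factorial : ℂ) ≠ 0 := by exact_mod_cast j.factorial_ne_zero
  have n3 : (k.factorial : ℂ) ≠ 0 := by exact_mod_cast k.factorial_ne_zero
  have n4 : (l.factorial : ℂ) ≠ 0 := by exact_mod_cast l.factorial_ne_zero
  have key : ∀ (c1 c2 c3 d1 d2 d3 : ℂ) (u v : PP), c1 * c2 * c3 = d1 * d2 * d3 →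
      C c1 * (C c2 * (C c3 * u * v)) = C d1 * (u * (C d2 * (C d3 * v))) := by
    intro c1 c2 c3 d1 d2 d3 u v h
    have := congrArg (C : ℂ → PP) h
    simp only [map_mul] at this
    linear_combination (u * v) * this
  apply key
  push_cast
  rw [pow_add, ← e1, ← e2]
  rw [← e1] at n1
  rw [← e2] at n2
  have m1 := left_ne_zero_of_mul n1
  have m2 := left_ne_zero_of_mul n2
  have m3 := right_ne_zero_of_mul n1
  have m4 := right_ne_zero_of_mul n2
  field_simp

lemma HH_const {δ : Derivation ℂ PP PP} {B D : PP} (hB : δ B = 0) (hD : δ D = 0) (p q T : ℕ)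
    (β γ : ℂ) : δ (HH p q T β γ B D) = 0 := by
  rw [HH, map_sum]
  refine sum_eq_zero fun s hs => ?_
  simp [Derivation.leibniz, Derivation.leibniz_pow, hB, hD]

lemma choose_C (K t : ℕ) (h : t ≤ K) : ((K - t).factorial : ℂ) / K.factorial * t.factorial =
    1 / (K.choose t) := by
  have := Nat.choose_mul_factorial_mul_factorial h
  have h2 : (K.choose t : ℂ) * t.factorial * (K - t).factorial = K.factorial := by exact_mod_cast this
  have n1 : (K.factorial : ℂ) ≠ 0 := by exact_mod_cast K.factorial_ne_zero
  have n2 : (K.choose t : ℂ) ≠ 0 := by exact_mod_cast (Nat.choose_pos h).ne'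
  field_simp
  rw [← h2]; ring

lemma sym2 (i j K L t u p q p' q' : ℕ) (a b c a' b' c' g : ℂ)
    (ht : t ≤ i) (htK : t ≤ K) (hu : u ≤ j) (huL : u ≤ L) :
    symProd i j K L t u (la a ^ i * lb a' ^ j)
      (C g * ((la b ^ p * la c ^ q) * (lb b' ^ p' * lb c' ^ q'))) =
    C (g / (K.choose t * L.choose u)) * ((la a ^ (i - t) * HH p q t (a - b) (a - c) (la b) (la c)) *
      (lb a' ^ (j - u) * HH p' q' u (a' - b') (a' - c') (lb b') (lb c'))) := by
  rw [symProd_la _ _ _ _ _ _ _ _ _ ht htK hu huL, ← smul_eq_C_mul (a := g), map_smul]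
  have hG : Db a' (la b ^ p * la c ^ q) = 0 := by
    simp [Derivation.leibniz, Derivation.leibniz_pow, Db_la]
  rw [der_HH hG (Db_lb a' b') (Db_lb a' c')]
  have hG' : Da a (HH p' q' u (a' - b') (a' - c') (lb b') (lb c')) = 0 :=
    HH_const (Da_lb _ _) (Da_lb _ _) _ _ _ _ _
  rw [mul_comm (la b ^ p * la c ^ q), ← smul_eq_C_mul (a := (u.factorial : ℂ)), map_smul, map_smul,
    der_HH hG' (Da_la a b) (Da_la a c)]
  simp only [smul_eq_C_mul]
  have h1 := choose_C K t htK
  have h2 := choose_C L u huL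
  have e : g / (K.choose t * L.choose u : ℂ) =
      (((K - t).factorial * (L - u).factorial : ℂ) / (K.factorial * L.factorial)) * g *
        u.factorial * t.factorial := by
    calc g / (K.choose t * L.choose u : ℂ) = g * (1 / (K.choose t : ℂ)) * (1 / (L.choose u : ℂ)) := by
          rw [div_mul_eq_div_mul_one_div]; ring
      _ = _ := by rw [← h1, ← h2, mul_div_mul_comm]; ring
  rw [e]
  simp only [map_mul]
  ring

lemma HH_zero (k m : ℕ) (β γ : ℂ) (B D : PP) :
    HH 0 k m β γ B D = C (k.choose m * γ ^ m) * D ^ (k - m) := by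
  rw [HH, sum_eq_single 0]
  · simp [MvPolynomial.algebraMap_eq]
  · intro s _ hs
    rw [Nat.choose_eq_zero_of_lt (by omega : 0 < s)]
    simp
  · simp

lemma sym1 (r s k l m n : ℕ) (b c b' c' : ℂ) (hr : m ≤ r) (hk : m ≤ k) (hs : n ≤ s) (hl : n ≤ l) :
    symProd r s k l m n (la b ^ r * lb b' ^ s) (la c ^ k * lb c' ^ l) =
    C ((b - c) ^ m * (b' - c') ^ n) * ((la b ^ (r - m) * la c ^ (k - m)) *
      (lb b' ^ (s - n) * lb c' ^ (l - n))) := by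
  have := sym2 r s k l m n 0 k 0 l b 0 c b' 0 c' 1 hr hk hs hl
  rw [C_1, one_mul, pow_zero, pow_zero, one_mul, one_mul, HH_zero,
    HH_zero] at this
  rw [this]
  have n1 : (k.choose m : ℂ) ≠ 0 := by exact_mod_cast (Nat.choose_pos hk).ne'
  have n2 : (l.choose n : ℂ) ≠ 0 := by exact_mod_cast (Nat.choose_pos hl).ne'
  have e : (b - c) ^ m * (b' - c') ^ n = 1 / (k.choose m * l.choose n : ℂ) *
    (k.choose m * (b - c) ^ m) * (l.choose n * (b' - c') ^ n) := by field_simp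
  rw [e, map_mul C (_ * _), map_mul C (1 / _)]
  ring

lemma la_ne (a : ℂ) : la a ≠ 0 := by
  intro h
  have := congrArg (MvPolynomial.eval (![1, 0, 0, 0] : Fin 4 → ℂ)) h
  simp [la] at this

lemma lb_ne (a : ℂ) : lb a ≠ 0 := by
  intro h
  have := congrArg (MvPolynomial.eval (![0, 0, 1, 0] : Fin 4 → ℂ)) h
  simp [lb] at this

lemma main_gen (i j r s k l m n t u : ℕ) (a b c a' b' c' : ℂ)
    (hm : m ≤ min r k) (hn : n ≤ min s l)
    (ht : t ≤ min i (r + k - 2 * m)) (hu : u ≤ min j (s + l - 2 * n)) :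
    symProd i j (r + k - 2 * m) (s + l - 2 * n) (t : ℤ) (u : ℤ) (la a ^ i * lb a' ^ j)
        (symProd r s k l (m : ℤ) (n : ℤ) (la b ^ r * lb b' ^ s) (la c ^ k * lb c' ^ l)) =
      ∑ M ∈ Finset.range (min i k + 1), ∑ N ∈ Finset.range (min j l + 1),
        (((Fcoef i r k t m M * Fcoef j s l u n N : ℚ)) : ℂ) •
          symProd r s (i + k - 2 * M) (j + l - 2 * N)
            ((t : ℤ) + (m : ℤ) - (M : ℤ)) ((u : ℤ) + (n : ℤ) - (N : ℤ)) (la b ^ r * lb b' ^ s)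
            (symProd i j k l (M : ℤ) (N : ℤ) (la a ^ i * lb a' ^ j) (la c ^ k * lb c' ^ l)) := by
  rw [sym1 _ _ _ _ _ _ _ _ _ _ (by omega) (by omega) (by omega) (by omega),
    sym2 _ _ _ _ _ _ _ _ _ _ _ _ _ _ _ _ _ (by omega) (by omega) (by omega) (by omega)]
  have o1 := oneFactor i r k t m (by omega) (by omega) (by omega) a b c (la a) (la b) (la c)
    (la_ne a) (la_ne b) (la_ne c) (by
      simp only [MvPolynomial.algebraMap_eq, la, map_sub]; ring)
  have o2 := oneFactor j s l u n (by omega) (by omega) (by omega) a' b' c' (lb a') (lb b') (lb c')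
    (lb_ne a') (lb_ne b') (lb_ne c') (by
      simp only [MvPolynomial.algebraMap_eq, lb, map_sub]; ring)
  simp only [MvPolynomial.algebraMap_eq] at o1 o2
  rw [mul_div_mul_comm, map_mul C, mul_mul_mul_comm, o1, o2, sum_mul_sum]
  refine sum_congr rfl fun M hM => sum_congr rfl fun N hN => ?_
  simp only [mem_range] at hM hN
  rw [sym1 _ _ _ _ _ _ _ _ _ _ (by omega) (by omega) (by omega) (by omega)]
  by_cases h1 : M ≤ t + m ∧ t + m ≤ r + M ∧ t + m + M ≤ i + k
  · by_cases h2 : N ≤ u + n ∧ u + n ≤ s + N ∧ u + n + N ≤ j + l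
    · rw [if_pos h1, if_pos h2]
      rw [show (t : ℤ) + m - M = ((t + m - M : ℕ) : ℤ) by omega,
        show (u : ℤ) + n - N = ((u + n - N : ℕ) : ℤ) by omega,
        sym2 _ _ _ _ _ _ _ _ _ _ _ _ _ _ _ _ _ (by omega) (by omega) (by omega) (by omega),
        smul_eq_C_mul, mul_mul_mul_comm, ← map_mul C,
        ← mul_assoc (C (((Fcoef i r k t m M * Fcoef j s l u n N : ℚ)) : ℂ)), ← map_mul C]
      congr 2
      push_cast
      ring
    · rw [if_neg h2, mul_zero, symProd, if_neg, smul_zero]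
      contrapose! h2
      omega
  · rw [if_neg h1, zero_mul, symProd, if_neg, smul_zero]
    contrapose! h1
    omega


/-- Corollary 3: commutation relation for iterated symmetric products. -/
theorem stmt3 (i j r s k l m n t u : ℕ) (φ ω ϕ : MvPolynomial (Fin 4) ℂ)
    (hφ : SS i j φ) (hω : SS r s ω) (hϕ : SS k l ϕ)
    (hm : m ≤ min r k) (hn : n ≤ min s l)
    (ht : t ≤ min i (r + k - 2 * m)) (hu : u ≤ min j (s + l - 2 * n)) :
    symProd i j (r + k - 2 * m) (s + l - 2 * n) (t : ℤ) (u : ℤ) φ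
        (symProd r s k l (m : ℤ) (n : ℤ) ω ϕ) =
      ∑ M ∈ Finset.range (min i k + 1), ∑ N ∈ Finset.range (min j l + 1),
        (((Fcoef i r k t m M * Fcoef j s l u n N : ℚ)) : ℂ) •
          symProd r s (i + k - 2 * M) (j + l - 2 * N)
            ((t : ℤ) + (m : ℤ) - (M : ℤ)) ((u : ℤ) + (n : ℤ) - (N : ℤ)) ω
            (symProd i j k l (M : ℤ) (N : ℤ) φ ϕ) := by
  choose S hS using symProd_lin
  have key : ∀ a a' b b' c c', _ := fun a a' b b' c c' =>
    main_gen i j r s k l m n t u a b c a' b' c' hm hn ht hu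
  simp only [hS] at key ⊢
  have h1 := span_SS i j φ hφ
  have h2 := span_SS r s ω hω
  have h3 := span_SS k l ϕ hϕ
  clear hφ hω hϕ
  induction h1 using Submodule.span_induction with
  | zero => simp
  | add x y _ _ hx hy => simp only [map_add, LinearMap.add_apply, smul_add, sum_add_distrib, hx, hy]
  | smul z x _ hx =>
    simp only [map_smul, LinearMap.smul_apply, hx, smul_sum]
    exact sum_congr rfl fun _ _ => sum_congr rfl fun _ _ => smul_comm _ _ _
  | mem x hx =>
  obtain ⟨⟨a, a'⟩, rfl⟩ := hx
  induction h2 using Submodule.span_induction with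
  | zero => simp
  | add x y _ _ hx hy => simp only [map_add, LinearMap.add_apply, smul_add, sum_add_distrib, hx, hy]
  | smul z x _ hx =>
    simp only [map_smul, LinearMap.smul_apply, hx, smul_sum]
    exact sum_congr rfl fun _ _ => sum_congr rfl fun _ _ => smul_comm _ _ _
  | mem x hx =>
  obtain ⟨⟨b, b'⟩, rfl⟩ := hx
  induction h3 using Submodule.span_induction with
  | zero => simp
  | add x y _ _ hx hy => simp only [map_add, smul_add, sum_add_distrib, hx, hy]
  | smul z x _ hx =>
    simp only [map_smul, hx, smul_sum]
    exact sum_congr rfl fun _ _ => sum_congr rfl fun _ _ => smul_comm _ _ _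
  | mem x hx =>
  obtain ⟨⟨c, c'⟩, rfl⟩ := hx
  exact key a a' b b' c c'
end
end

section
/- Irreducible (Clebsch–Gordan) decomposition of a product of symmetric spinors (Lemma 4, trace-free unprimed case, in the binary-form model): for all homogeneous polynomials φ ∈ S_i and ψ ∈ S_k in the variables (x,y), one has the identity of polynomials in ℂ[x,y,u,v]: φ(x,y)·ψ(u,v) = Σ_{m=0}^{min(i,k)} ((−1)^m · C(i,m)·C(k,m) / C(i+k−m+1,m)) · (x·v − y·u)^m · ((i−m)!/(i+k−2m)!) · (u·∂_x + v·∂_y)^{k−m} applied to (φ ⊙_m ψ)(x,y). -/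
open MvPolynomial Finset

noncomputable section

/-- Iterated partial derivatives `∂x^a ∂y^b` on `ℂ[x,y]`, with `x = X 0`, `y = X 1`. -/
def Dxy (a b : ℕ) (P : MvPolynomial (Fin 2) ℂ) : MvPolynomial (Fin 2) ℂ :=
  (fun Q => pderiv (0 : Fin 2) Q)^[a] ((fun Q => pderiv (1 : Fin 2) Q)^[b] P)

/-- The symmetric product `φ ⊙_m ψ` for `φ ∈ S_i`, `ψ ∈ S_k` homogeneous in `(x,y)`;
defined to be `0` if `m > min(i,k)`. -/
def symProd1 (i k m : ℕ) (φ ψ : MvPolynomial (Fin 2) ℂ) : MvPolynomial (Fin 2) ℂ :=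
  if m ≤ min i k then
    ((((i - m).factorial * (k - m).factorial : ℕ) : ℂ) /
        (((i.factorial * k.factorial : ℕ)) : ℂ)) •
      ∑ a ∈ Finset.range (m + 1),
        ((-1 : ℂ) ^ a * (m.choose a : ℂ)) • (Dxy a (m - a) φ * Dxy (m - a) a ψ)
  else 0

/-- The polarization operator `u·∂x + v·∂y` on `ℂ[x,y,u,v]`
(`x = X 0`, `y = X 1`, `u = X 2`, `v = X 3`). -/
def Pol (P : MvPolynomial (Fin 4) ℂ) : MvPolynomial (Fin 4) ℂ :=
  X 2 * pderiv (0 : Fin 4) P + X 3 * pderiv (1 : Fin 4) P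

namespace CG

abbrev R4 := MvPolynomial (Fin 4) ℂ

def w1 : Fin 4 → ℕ := ![1, 1, 0, 0]
def w2 : Fin 4 → ℕ := ![0, 0, 1, 1]

/-- Partial derivative as an endomorphism. -/
def D (j : Fin 4) : Module.End ℂ R4 := (pderiv j : Derivation ℂ R4 R4).toLinearMap

lemma D_apply (j : Fin 4) (F : R4) : D j F = pderiv j F := rfl

lemma D_comm (a b : Fin 4) : Commute (D a) (D b) := by
  have h : ⁅(pderiv a : Derivation ℂ R4 R4), (pderiv b : Derivation ℂ R4 R4)⁆ = 0 := by
    apply MvPolynomial.derivation_ext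
    intro j
    simp only [Derivation.commutator_apply, pderiv_X, Pi.single_apply]
    split_ifs <;> simp
  apply LinearMap.ext
  intro F
  have := congrArg (fun d : Derivation ℂ R4 R4 => d F) h
  simp only [Derivation.commutator_apply, Derivation.zero_apply] at this
  exact sub_eq_zero.mp this

lemma pd_comm (a b : Fin 4) (F : R4) : pderiv a (pderiv b F) = pderiv b (pderiv a F) :=
  LinearMap.congr_fun (D_comm a b) F

def P : Module.End ℂ R4 :=
  LinearMap.mulLeft ℂ (X 2) * D 0 + LinearMap.mulLeft ℂ (X 3) * D 1
def Q : Module.End ℂ R4 :=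
  LinearMap.mulLeft ℂ (X 0) * D 2 + LinearMap.mulLeft ℂ (X 1) * D 3
def Om : Module.End ℂ R4 := D 1 * D 2 - D 0 * D 3

lemma P_apply (F : R4) : P F = X 2 * pderiv 0 F + X 3 * pderiv 1 F := rfl
lemma Q_apply (F : R4) : Q F = X 0 * pderiv 2 F + X 1 * pderiv 3 F := rfl
lemma Om_apply (F : R4) : Om F = pderiv 1 (pderiv 2 F) - pderiv 0 (pderiv 3 F) := rfl

def Del : R4 := X 0 * X 3 - X 1 * X 2

lemma P_Del (F : R4) : P (Del * F) = Del * P F := by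
  simp [P_apply, Del, pderiv_X, Pi.single_apply]
  ring

lemma P_Del_pow (m : ℕ) (F : R4) : P (Del ^ m * F) = Del ^ m * P F := by
  induction m generalizing F with
  | zero => simp
  | succ m ih => rw [pow_succ, mul_assoc, ih, P_Del, mul_assoc]

lemma Om_Q : Commute Om Q := by
  apply LinearMap.ext
  intro F
  simp only [Module.End.mul_apply, Om_apply, Q_apply]
  simp [pderiv_X, Pi.single_apply]
  rw [pd_comm 3 2, pd_comm 2 1, pd_comm 2 0, pd_comm 3 1, pd_comm 3 0, pd_comm 3 2]
  ring

structure B (i k : ℕ) (F : R4) : Prop where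
  h1 : IsWeightedHomogeneous w1 F i
  h2 : IsWeightedHomogeneous w2 F k

lemma notMem_vars {w : Fin 4 → ℕ} {F : R4} (h : IsWeightedHomogeneous w F 0) (j : Fin 4)
    (hj : w j ≠ 0) : j ∉ F.vars := by
  intro hm
  rw [mem_vars_iff_mem_support] at hm
  obtain ⟨d, hd, hjd⟩ := hm
  have := h (mem_support_iff.mp hd)
  rw [Finsupp.weight_apply, Finsupp.sum, Finset.sum_eq_zero_iff] at this
  have := this j hjd
  simp at this
  rcases this with h | h
  · exact (Finsupp.mem_support_iff.mp hjd) h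
  · exact hj h

lemma pd_zero {w : Fin 4 → ℕ} {F : R4} (h : IsWeightedHomogeneous w F 0) (j : Fin 4)
    (hj : w j ≠ 0) : pderiv j F = 0 :=
  pderiv_eq_zero_of_notMem_vars (notMem_vars h j hj)

lemma euler1 {i k : ℕ} {F : R4} (h : B i k F) :
    X 0 * pderiv 0 F + X 1 * pderiv 1 F = (i : R4) * F := by
  have := h.h1.sum_weight_X_mul_pderiv
  simpa [Fin.sum_univ_four, w1] using this

lemma euler2 {i k : ℕ} {F : R4} (h : B i k F) :
    X 2 * pderiv 2 F + X 3 * pderiv 3 F = (k : R4) * F := by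
  have := h.h2.sum_weight_X_mul_pderiv
  simpa [Fin.sum_univ_four, w2] using this

lemma capelli {i k : ℕ} {F : R4} (h : B i k F) :
    P (Q F) - Del * Om F = (((i + 1) * k : ℂ)) • F := by
  have e1 := euler1 h
  have e2 := euler2 h
  have a0 := congrArg (pderiv 0) e2
  have a1 := congrArg (pderiv 1) e2
  simp [pderiv_X, Pi.single_apply] at a0 a1
  simp only [P_apply, Q_apply, Om_apply, Del]
  simp [pderiv_X, Pi.single_apply]
  rw [MvPolynomial.smul_eq_C_mul]
  simp
  rw [pd_comm 1 2, pd_comm 0 3] at *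
  rw [pd_comm 0 2, pd_comm 1 3] at *
  linear_combination e2 + (k : R4) * e1 + X 0 * a0 + X 1 * a1

lemma B_Q {i k : ℕ} {F : R4} (h : B i (k + 1) F) : B (i + 1) k (Q F) := by
  rw [Q_apply]
  constructor
  · have t (j l : Fin 4) (hj : w1 j = 1) (hl : w1 l = 0) :
        IsWeightedHomogeneous w1 (X j * pderiv l F) (i + 1) := by
      rw [add_comm]
      refine IsWeightedHomogeneous.mul ?_ (h.h1.pderiv (by simp [hl]))
      rw [← hj]; exact isWeightedHomogeneous_X _ _ _
    exact (t 0 2 rfl rfl).add (t 1 3 rfl rfl)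
  · have t (j l : Fin 4) (hj : w2 j = 0) (hl : w2 l = 1) :
        IsWeightedHomogeneous w2 (X j * pderiv l F) k := by
      rw [← zero_add k]
      refine IsWeightedHomogeneous.mul ?_ (h.h2.pderiv (by simp [hl]))
      rw [← hj]; exact isWeightedHomogeneous_X _ _ _
    exact (t 0 2 rfl rfl).add (t 1 3 rfl rfl)

lemma B_Om {i k : ℕ} {F : R4} (h : B (i + 1) (k + 1) F) : B i k (Om F) := by
  rw [Om_apply]
  constructor
  · have t (j l : Fin 4) (hj : w1 j = 1) (hl : w1 l = 0) :
        IsWeightedHomogeneous w1 (pderiv j (pderiv l F)) i :=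
      (h.h1.pderiv (n' := i + 1) (by simp [hl])).pderiv (by simp [hj])
    exact (t 1 2 rfl rfl).sub (t 0 3 rfl rfl)
  · have t (j l : Fin 4) (hj : w2 j = 0) (hl : w2 l = 1) :
        IsWeightedHomogeneous w2 (pderiv j (pderiv l F)) k :=
      (h.h2.pderiv (n' := k) (by simp [hl])).pderiv (by simp [hj])
    exact (t 1 2 rfl rfl).sub (t 0 3 rfl rfl)

lemma Om_zero {k : ℕ} {F : R4} (h : B 0 k F) : Om F = 0 := by
  rw [Om_apply, pd_comm 1, pd_comm 0, pd_zero h.h1 0 (by simp [w1]), pd_zero h.h1 1 (by simp [w1])]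
  simp

lemma Om_pow_zero {i k m : ℕ} {F : R4} (h : B i k F) (hm : i < m) (hk : m ≤ k) :
    (Om ^ m) F = 0 := by
  induction i generalizing k m F with
  | zero =>
    obtain ⟨m, rfl⟩ : ∃ n, m = n + 1 := ⟨m - 1, by omega⟩
    rw [pow_succ, Module.End.mul_apply, Om_zero h, map_zero]
  | succ i ih =>
    obtain ⟨m, rfl⟩ : ∃ n, m = n + 1 := ⟨m - 1, by omega⟩
    obtain ⟨k, rfl⟩ : ∃ n, k = n + 1 := ⟨k - 1, by omega⟩
    rw [pow_succ, Module.End.mul_apply, ih (B_Om h) (by omega) (by omega)]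

/-- the coefficient -/
def c (i k m : ℕ) : ℂ :=
  ((i - m).factorial * ((i + k - 2 * m : ℕ) + 1)) /
    (m.factorial * (k - m).factorial * (i + k - m + 1).factorial)

lemma fne (n : ℕ) : (n.factorial : ℂ) ≠ 0 := by exact_mod_cast n.factorial_ne_zero

lemma c_rec (p q m : ℕ) :
    ((m + 1 + p + 1 : ℂ) * (m + 1 + q)) * c (m + 1 + p) (m + 1 + q) (m + 1) =
      (if q = 0 then 0 else c (m + 1 + p + 1) (m + q) (m + 1)) + c (m + p) (m + q) m := by
  rcases q with _ | q
  · simp only [c, if_true]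
    rw [show m + 1 + p - (m + 1) = p by omega, show m + 1 + 0 - (m + 1) = 0 by omega,
      show m + 1 + p + (m + 1 + 0) - 2 * (m + 1) = p by omega,
      show m + 1 + p + (m + 1 + 0) - (m + 1) + 1 = m + p + 1 + 1 by omega,
      show m + p - m = p by omega, show m + 0 - m = 0 by omega,
      show m + p + (m + 0) - 2 * m = p by omega,
      show m + p + (m + 0) - m + 1 = m + p + 1 by omega]
    have h1 := fne m
    have h2 := fne (m + p + 1)
    have h3 : (m + p + 1 + 1 : ℂ) ≠ 0 := by exact_mod_cast (by omega : (m + p + 1 + 1 : ℕ) ≠ 0)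
    have h4 : (m + 1 : ℂ) ≠ 0 := by exact_mod_cast (by omega : (m + 1 : ℕ) ≠ 0)
    rw [Nat.factorial_succ (m + p + 1), Nat.factorial_succ m]
    push_cast
    field_simp
    ring
  · simp only [c, if_neg (Nat.succ_ne_zero q)]
    rw [show m + 1 + p - (m + 1) = p by omega, show m + 1 + (q + 1) - (m + 1) = q + 1 by omega,
      show m + 1 + p + (m + 1 + (q + 1)) - 2 * (m + 1) = p + q + 1 by omega,
      show m + 1 + p + (m + 1 + (q + 1)) - (m + 1) + 1 = m + p + q + 2 + 1 by omega,
      show m + p - m = p by omega, show m + (q + 1) - m = q + 1 by omega,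
      show m + p + (m + (q + 1)) - 2 * m = p + q + 1 by omega,
      show m + p + (m + (q + 1)) - m + 1 = m + p + q + 2 by omega,
      show m + 1 + p + 1 - (m + 1) = p + 1 by omega, show m + (q + 1) - (m + 1) = q by omega,
      show m + 1 + p + 1 + (m + (q + 1)) - 2 * (m + 1) = p + q + 1 by omega,
      show m + 1 + p + 1 + (m + (q + 1)) - (m + 1) + 1 = m + p + q + 2 + 1 by omega]
    have h1 := fne m
    have h2 := fne (m + p + q + 2)
    have h3 : (m + p + q + 2 + 1 : ℂ) ≠ 0 := by exact_mod_cast (by omega : (m + p + q + 2 + 1 : ℕ) ≠ 0)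
    have h4 : (m + 1 : ℂ) ≠ 0 := by exact_mod_cast (by omega : (m + 1 : ℕ) ≠ 0)
    have h5 : (q + 1 : ℂ) ≠ 0 := by exact_mod_cast (by omega : (q + 1 : ℕ) ≠ 0)
    have h6 := fne q
    rw [Nat.factorial_succ (m + p + q + 2), Nat.factorial_succ m, Nat.factorial_succ q,
      Nat.factorial_succ p]
    push_cast
    field_simp
    ring

lemma c_rec0 (i k : ℕ) : ((i + 1 : ℂ) * (k + 1)) * c i (k + 1) 0 = c (i + 1) k 0 := by
  simp only [c]
  simp only [Nat.sub_zero, mul_zero]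
  rw [show i + (k + 1) + 1 = i + k + 1 + 1 by omega, show i + 1 + k + 1 = i + k + 1 + 1 by omega,
      show i + (k + 1) = i + k + 1 by omega, show i + 1 + k = i + k + 1 by omega]
  have h1 := fne k
  have h2 := fne (i + k + 1 + 1)
  have h5 : (k + 1 : ℂ) ≠ 0 := by exact_mod_cast (by omega : (k + 1 : ℕ) ≠ 0)
  rw [Nat.factorial_succ k, Nat.factorial_succ i]
  push_cast
  field_simp

/-- basic term -/
def T (k m : ℕ) (F : R4) : R4 := Del ^ m * (P ^ (k - m)) ((Q ^ (k - m)) ((Om ^ m) F))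

lemma T_zero {i k m : ℕ} {F : R4} (h : B i k F) (hm : i < m) (hk : m ≤ k) : T k m F = 0 := by
  simp [T, Om_pow_zero h hm hk]

lemma P_T_Q {k m : ℕ} (hm : m ≤ k) (F : R4) : P (T k m (Q F)) = T (k + 1) m F := by
  unfold T
  rw [P_Del_pow, show k + 1 - m = (k - m) + 1 by omega, pow_succ', pow_succ]
  simp only [Module.End.mul_apply]
  have := LinearMap.congr_fun (Om_Q.pow_left m) F
  simp only [Module.End.mul_apply] at this
  rw [this]

lemma Del_T_Om {k m : ℕ} (F : R4) : Del * (T k m (Om F)) = T (k + 1) (m + 1) F := by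
  unfold T
  rw [← mul_assoc, ← pow_succ', show k + 1 - (m + 1) = k - m by omega, pow_succ Om,
    Module.End.mul_apply]

theorem main {i k : ℕ} {F : R4} (h : B i k F) :
    F = ∑ m ∈ range (k + 1), ((-1 : ℂ) ^ m * c i k m) • T k m F := by
  induction k generalizing i F with
  | zero =>
    have : c i 0 0 = 1 := by
      simp only [c]
      have := fne i
      have h5 : (i + 1 : ℂ) ≠ 0 := by exact_mod_cast (by omega : (i + 1 : ℕ) ≠ 0)
      simp [Nat.factorial_succ]
      field_simp
    simp [T, this]
  | succ k ih =>
    have hne : (((i + 1) * (k + 1) : ℂ)) ≠ 0 := by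
      exact_mod_cast Nat.mul_ne_zero (Nat.succ_ne_zero i) (Nat.succ_ne_zero k)
    have hc := capelli h
    have hQ : P (Q F) = ∑ m ∈ range (k + 1), ((-1 : ℂ) ^ m * c (i + 1) k m) • T (k + 1) m F := by
      conv_lhs => rw [ih (B_Q h)]
      rw [map_sum]
      refine sum_congr rfl fun m hm => ?_
      rw [map_smul, P_T_Q (by simp at hm; omega)]
    have hO : Del * Om F =
        ∑ m ∈ range (k + 1), ((-1 : ℂ) ^ m * c (i - 1) k m) • T (k + 1) (m + 1) F := by
      rcases i with _ | i
      · rw [Om_zero h, mul_zero]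
        symm
        refine sum_eq_zero fun m hm => ?_
        rw [T_zero h (by omega) (by simp at hm; omega), smul_zero]
      · conv_lhs => rw [ih (B_Om h)]
        rw [mul_sum]
        refine sum_congr rfl fun m hm => ?_
        rw [mul_smul_comm, Del_T_Om]; rfl
    rw [hQ, hO] at hc
    push_cast at hc
    apply smul_right_injective R4 hne
    show ((i + 1 : ℂ) * (k + 1)) • F = ((i + 1 : ℂ) * (k + 1)) • _
    rw [← hc, sum_range_succ', sum_range_succ' _ (k + 1), smul_add, smul_sum, add_sub_right_comm]
    have hlast : ∑ m ∈ range k, ((-1 : ℂ) ^ (m + 1) * c (i + 1) k (m + 1)) • T (k + 1) (m + 1) F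
        = ∑ m ∈ range (k + 1), ((-1 : ℂ) ^ (m + 1) *
          (if m = k then 0 else c (i + 1) k (m + 1))) • T (k + 1) (m + 1) F := by
      rw [sum_range_succ]
      simp only [if_true, mul_zero, zero_smul, add_zero]
      refine sum_congr rfl fun m hm => ?_
      rw [if_neg (by simp at hm; omega)]
    rw [hlast, ← sum_sub_distrib]
    congr 1
    · refine sum_congr rfl fun m hm => ?_
      have hm' : m ≤ k := by simp at hm; omega
      by_cases hi : i < m + 1
      · rw [T_zero h hi (by omega)]; simp
      · obtain ⟨p, rfl⟩ : ∃ p, i = m + 1 + p := ⟨i - (m + 1), by omega⟩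
        obtain ⟨q, rfl⟩ : ∃ q, k = m + q := ⟨k - m, by omega⟩
        have := c_rec p q m
        rw [smul_smul, ← sub_smul]
        congr 1
        rw [show m + 1 + p - 1 = m + p by omega]
        have e : (m = m + q) = (q = 0) := by simp
        simp only [e]
        rw [show m + 1 + q = m + q + 1 by omega] at this
        push_cast
        rw [pow_succ]
        linear_combination (-1) * (-1 : ℂ) ^ m * (-1) * this
    · rw [smul_smul]
      congr 1
      have := c_rec0 i k
      linear_combination -this

def S : R4 →ₐ[ℂ] R4 := aeval ![X 0, X 1, X 0, X 1]

lemma S_Q {i k : ℕ} {F : R4} (h : B i k F) : S (Q F) = (k : R4) * S F := by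
  have := congrArg S (euler2 h)
  rw [Q_apply]
  simp [S] at this ⊢
  exact this

lemma S_inv {i : ℕ} {F : R4} (h : B i 0 F) : S F = F := by
  refine hom_congr_vars (f₁ := (S : R4 →+* R4)) (f₂ := RingHom.id R4) ?_ ?_ rfl
  · ext x <;> simp [S]
  · intro j hj _
    have n2 := notMem_vars h.h2 2 (by simp [w2])
    have n3 := notMem_vars h.h2 3 (by simp [w2])
    fin_cases j
    · simp [S]
    · simp [S]
    · exact absurd hj n2
    · exact absurd hj n3

lemma Q_pow {i k : ℕ} {F : R4} (h : B i k F) : (Q ^ k) F = (k.factorial : R4) * S F := by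
  induction k generalizing i F with
  | zero => simp [S_inv h]
  | succ k ih =>
    rw [pow_succ, Module.End.mul_apply, ih (B_Q h), S_Q h, Nat.factorial_succ]
    push_cast; ring

lemma B_Om_pow {i k m : ℕ} {F : R4} (h : B (i + m) (k + m) F) : B i k ((Om ^ m) F) := by
  induction m generalizing F with
  | zero => simpa using h
  | succ m ih =>
    rw [pow_succ, Module.End.mul_apply]
    exact ih (B_Om h)

abbrev r1 : MvPolynomial (Fin 2) ℂ →ₐ[ℂ] R4 := rename (![0, 1] : Fin 2 → Fin 4)
abbrev r2 : MvPolynomial (Fin 2) ℂ →ₐ[ℂ] R4 := rename (![2, 3] : Fin 2 → Fin 4)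

lemma wh_rename {w : Fin 4 → ℕ} (f : Fin 2 → Fin 4) (n i : ℕ) {φ : MvPolynomial (Fin 2) ℂ}
    (hφ : φ.IsHomogeneous i) (hw : ∀ j, w (f j) = n) :
    IsWeightedHomogeneous w (rename f φ) (n * i) := by
  rw [φ.as_sum, map_sum]
  refine IsWeightedHomogeneous.sum _ _ _ fun d hd => ?_
  rw [rename_monomial]
  apply isWeightedHomogeneous_monomial
  have := hφ (mem_support_iff.mp hd)
  rw [Finsupp.weight_apply, Finsupp.sum_mapDomain_index (by simp) (by intros; rw [add_smul])]
  rw [Finsupp.weight_apply] at this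
  rw [← this]
  simp only [Finsupp.sum, hw, smul_eq_mul, Pi.one_apply, mul_one, mul_sum]
  exact sum_congr rfl fun _ _ => mul_comm _ _

lemma B_prod {i k : ℕ} {φ ψ : MvPolynomial (Fin 2) ℂ} (hφ : φ.IsHomogeneous i)
    (hψ : ψ.IsHomogeneous k) : B i k (r1 φ * r2 ψ) := by
  constructor
  · have := (wh_rename (w := w1) ![0, 1] 1 i hφ (by intro j; fin_cases j <;> rfl)).mul
      (wh_rename (w := w1) ![2, 3] 0 k hψ (by intro j; fin_cases j <;> rfl))
    simpa using this
  · have := (wh_rename (w := w2) ![0, 1] 0 i hφ (by intro j; fin_cases j <;> rfl)).mul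
      (wh_rename (w := w2) ![2, 3] 1 k hψ (by intro j; fin_cases j <;> rfl))
    simpa using this

lemma inj1 : Function.Injective (![0, 1] : Fin 2 → Fin 4) := by decide
lemma inj2 : Function.Injective (![2, 3] : Fin 2 → Fin 4) := by decide

lemma pd_off (f : Fin 2 → Fin 4) (j : Fin 4) (hj : ∀ l, f l ≠ j) (φ : MvPolynomial (Fin 2) ℂ) :
    pderiv j (rename f φ) = 0 := by
  classical
  apply pderiv_eq_zero_of_notMem_vars
  intro h
  have := vars_rename f φ h
  rw [Finset.mem_image] at this
  obtain ⟨l, _, hl⟩ := this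
  exact hj l hl

lemma pd0 (φ ψ : MvPolynomial (Fin 2) ℂ) : pderiv 0 (r1 φ * r2 ψ) = r1 (pderiv 0 φ) * r2 ψ := by
  rw [pderiv_mul, pd_off ![2, 3] 0 (by decide)]
  have := pderiv_rename inj1 0 φ
  simp at this
  simp [this]
lemma pd1 (φ ψ : MvPolynomial (Fin 2) ℂ) : pderiv 1 (r1 φ * r2 ψ) = r1 (pderiv 1 φ) * r2 ψ := by
  rw [pderiv_mul, pd_off ![2, 3] 1 (by decide)]
  have := pderiv_rename inj1 1 φ
  simp at this
  simp [this]
lemma pd2 (φ ψ : MvPolynomial (Fin 2) ℂ) : pderiv 2 (r1 φ * r2 ψ) = r1 φ * r2 (pderiv 0 ψ) := by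
  rw [pderiv_mul, pd_off ![0, 1] 2 (by decide)]
  have := pderiv_rename inj2 0 ψ
  simp at this
  simp [this]
lemma pd3 (φ ψ : MvPolynomial (Fin 2) ℂ) : pderiv 3 (r1 φ * r2 ψ) = r1 φ * r2 (pderiv 1 ψ) := by
  rw [pderiv_mul, pd_off ![0, 1] 3 (by decide)]
  have := pderiv_rename inj2 1 ψ
  simp at this
  simp [this]

lemma D0_pow (a : ℕ) (φ ψ : MvPolynomial (Fin 2) ℂ) :
    (D 0 ^ a) (r1 φ * r2 ψ) = r1 ((fun Q => pderiv (0 : Fin 2) Q)^[a] φ) * r2 ψ := by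
  induction a with
  | zero => rfl
  | succ a ih => rw [pow_succ', Module.End.mul_apply, ih, D_apply, pd0, Function.iterate_succ_apply']
lemma D1_pow (a : ℕ) (φ ψ : MvPolynomial (Fin 2) ℂ) :
    (D 1 ^ a) (r1 φ * r2 ψ) = r1 ((fun Q => pderiv (1 : Fin 2) Q)^[a] φ) * r2 ψ := by
  induction a with
  | zero => rfl
  | succ a ih => rw [pow_succ', Module.End.mul_apply, ih, D_apply, pd1, Function.iterate_succ_apply']
lemma D2_pow (a : ℕ) (φ ψ : MvPolynomial (Fin 2) ℂ) :
    (D 2 ^ a) (r1 φ * r2 ψ) = r1 φ * r2 ((fun Q => pderiv (0 : Fin 2) Q)^[a] ψ) := by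
  induction a with
  | zero => rfl
  | succ a ih => rw [pow_succ', Module.End.mul_apply, ih, D_apply, pd2, Function.iterate_succ_apply']
lemma D3_pow (a : ℕ) (φ ψ : MvPolynomial (Fin 2) ℂ) :
    (D 3 ^ a) (r1 φ * r2 ψ) = r1 φ * r2 ((fun Q => pderiv (1 : Fin 2) Q)^[a] ψ) := by
  induction a with
  | zero => rfl
  | succ a ih => rw [pow_succ', Module.End.mul_apply, ih, D_apply, pd3, Function.iterate_succ_apply']

lemma term_eq (a b : ℕ) (φ ψ : MvPolynomial (Fin 2) ℂ) :
    ((D 0 * D 3) ^ a * (D 1 * D 2) ^ b) (r1 φ * r2 ψ) = r1 (Dxy a b φ) * r2 (Dxy b a ψ) := by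
  have h : (D 0 * D 3) ^ a * (D 1 * D 2) ^ b = D 0 ^ a * (D 1 ^ b * (D 2 ^ b * D 3 ^ a)) := by
    rw [(D_comm 0 3).mul_pow, (D_comm 1 2).mul_pow, mul_assoc, ← mul_assoc (D 3 ^ a),
      ((D_comm 3 1).pow_pow a b).eq, mul_assoc, ((D_comm 3 2).pow_pow a b).eq]
  rw [h, Module.End.mul_apply, Module.End.mul_apply, Module.End.mul_apply,
    D3_pow, D2_pow, D1_pow, D0_pow, Dxy, Dxy]

lemma neg_pow_smul (A : Module.End ℂ R4) (a : ℕ) : (-A) ^ a = ((-1 : ℂ) ^ a) • A ^ a := by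
  rw [← neg_one_smul ℂ A, smul_pow]

lemma Om_pow (m : ℕ) (φ ψ : MvPolynomial (Fin 2) ℂ) :
    (Om ^ m) (r1 φ * r2 ψ) = ∑ a ∈ range (m + 1),
      ((-1 : ℂ) ^ a * (m.choose a : ℂ)) • (r1 (Dxy a (m - a) φ) * r2 (Dxy (m - a) a ψ)) := by
  have hcomm : Commute (-(D 0 * D 3)) (D 1 * D 2) :=
    (((D_comm 0 1).mul_right (D_comm 0 2)).mul_left ((D_comm 3 1).mul_right (D_comm 3 2))).neg_left
  have h : Om = -(D 0 * D 3) + D 1 * D 2 := by unfold Om; abel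
  rw [h, hcomm.add_pow, LinearMap.sum_apply]
  refine sum_congr rfl fun a _ => ?_
  rw [← nsmul_eq_mul', LinearMap.smul_apply, neg_pow_smul, smul_mul_assoc, LinearMap.smul_apply,
    term_eq, mul_comm ((-1 : ℂ) ^ a), mul_smul, Nat.cast_smul_eq_nsmul]

lemma S_r (φ ψ : MvPolynomial (Fin 2) ℂ) : S (r1 φ * r2 ψ) = r1 (φ * ψ) := by
  have h1 : S.comp r1 = r1 := by ext j; fin_cases j <;> simp [S]
  have h2 : S.comp r2 = r1 := by ext j; fin_cases j <;> simp [S]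
  rw [map_mul, map_mul]
  congr 1
  · exact DFunLike.congr_fun h1 φ
  · exact DFunLike.congr_fun h2 ψ

lemma coef (p q m : ℕ) :
    (((-1 : ℂ) ^ m * ((m + p).choose m : ℂ) * ((m + q).choose m : ℂ)) /
            ((p + q + m + 1).choose m : ℂ)) * ((p.factorial : ℂ) / ((p + q).factorial : ℂ)) *
      (((p.factorial * q.factorial : ℕ) : ℂ) /
        ((((m + p).factorial * (m + q).factorial : ℕ)) : ℂ)) =
    (-1 : ℂ) ^ m * c (m + p) (m + q) m * q.factorial := by
  have a1 := fne m
  have a2 := fne p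
  have a3 := fne q
  have a4 := fne (m + p)
  have a5 := fne (m + q)
  have a6 := fne (p + q)
  have a7 := fne (p + q + m + 1)
  have a8 : (p + q + 1 : ℂ) ≠ 0 := by exact_mod_cast (by omega : (p + q + 1 : ℕ) ≠ 0)
  rw [Nat.cast_choose ℂ (show m ≤ m + p by omega), Nat.cast_choose ℂ (show m ≤ m + q by omega),
    Nat.cast_choose ℂ (show m ≤ p + q + m + 1 by omega)]
  unfold c
  rw [show m + p - m = p by omega, show m + q - m = q by omega,
    show p + q + m + 1 - m = p + q + 1 by omega, show m + p + (m + q) - 2 * m = p + q by omega,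
    show m + p + (m + q) - m + 1 = p + q + m + 1 by omega, Nat.factorial_succ (p + q)]
  push_cast
  field_simp

end CG

open CG in
/-- Lemma 4 (trace-free unprimed case, binary-form model): the irreducible
(Clebsch–Gordan) decomposition of `φ(x,y)·ψ(u,v)`. -/
theorem stmt4 (i k : ℕ) (φ ψ : MvPolynomial (Fin 2) ℂ)
    (hφ : φ.IsHomogeneous i) (hψ : ψ.IsHomogeneous k) :
    (rename (![0, 1] : Fin 2 → Fin 4) φ) * (rename (![2, 3] : Fin 2 → Fin 4) ψ) =
      ∑ m ∈ Finset.range (min i k + 1),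
        (((-1 : ℂ) ^ m * (i.choose m : ℂ) * (k.choose m : ℂ)) /
            ((i + k - m + 1).choose m : ℂ)) •
          ((X 0 * X 3 - X 1 * X 2) ^ m *
            ((((i - m).factorial : ℂ) / ((i + k - 2 * m).factorial : ℂ)) •
              Pol^[k - m] (rename (![0, 1] : Fin 2 → Fin 4) (symProd1 i k m φ ψ)))) := by
  have hB := B_prod hφ hψ
  have hPol : Pol = fun F => P F := rfl
  rw [show (rename (![0, 1] : Fin 2 → Fin 4) φ) * (rename (![2, 3] : Fin 2 → Fin 4) ψ)
    = r1 φ * r2 ψ from rfl]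
  conv_lhs => rw [main hB]
  rw [← sum_subset (s₁ := range (min i k + 1)) (s₂ := range (k + 1))]
  · refine sum_congr rfl fun m hm => ?_
    have hm' : m ≤ min i k := by simp at hm; omega
    obtain ⟨p, rfl⟩ : ∃ p, i = m + p := ⟨i - m, by omega⟩
    obtain ⟨q, rfl⟩ : ∃ q, k = m + q := ⟨k - m, by omega⟩
    rw [symProd1, if_pos hm']
    have hB' : B (p + m) (q + m) (r1 φ * r2 ψ) := by rwa [add_comm p, add_comm q]
    have hq := Q_pow (B_Om_pow hB')
    rw [T, show m + q - m = q by omega, show m + p - m = p by omega, hq, Om_pow]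
    have hS : S (∑ a ∈ range (m + 1), ((-1 : ℂ) ^ a * (m.choose a : ℂ)) •
        (r1 (Dxy a (m - a) φ) * r2 (Dxy (m - a) a ψ))) =
        r1 (∑ a ∈ range (m + 1), ((-1 : ℂ) ^ a * (m.choose a : ℂ)) •
          (Dxy a (m - a) φ * Dxy (m - a) a ψ)) := by
      simp only [map_sum, map_smul, S_r]
    rw [hS, map_smul, hPol, ← Module.End.coe_pow, map_smul, smul_smul, mul_smul_comm, smul_smul]
    have hn : ((q.factorial : ℕ) : R4) = C (q.factorial : ℂ) := by simp
    rw [hn, ← MvPolynomial.smul_eq_C_mul, map_smul, mul_smul_comm, smul_smul, ← coef,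
      show m + p + (m + q) - 2 * m = p + q by omega,
      show m + p + (m + q) - m + 1 = p + q + m + 1 by omega, mul_assoc]
    rfl
  · intro m hm; simp at hm ⊢; omega
  · intro m hm hm2
    simp at hm hm2
    rw [T_zero hB (by omega) (by omega), smul_zero]
end
end

section
/- Full contraction of symmetric basis elements (equation (BasisFullContraction) in the binary-form model): for all natural numbers k, l and all n, i ≤ k and m, j ≤ l, one has E^{n,m}_{k,l} ⊙_{k,l} E^{i,j}_{k,l} = (−1)^{n+m} · C(k,n)^{−1} · C(l,m)^{−1} if n = k−i and m = l−j, and E^{n,m}_{k,l} ⊙_{k,l} E^{i,j}_{k,l} = 0 otherwise. -/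
open MvPolynomial Finset

noncomputable section

/-- The symmetric dyad basis element `E^{n,m}_{k,l} = x^n y^(k-n) u^m v^(l-m) ∈ S_{k,l}`. -/
def Eb (k l n m : ℕ) : MvPolynomial (Fin 4) ℂ :=
  X 0 ^ n * X 1 ^ (k - n) * X 2 ^ m * X 3 ^ (l - m)

theorem iter_pderiv (i : Fin 4) (a : ℕ) (s : Fin 4 →₀ ℕ) (c : ℂ) :
    (fun Q => pderiv i Q)^[a] (monomial s c) =
      monomial (s - Finsupp.single i a) (c * ((s i).descFactorial a : ℂ)) := by
  induction a with
  | zero => simp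
  | succ a ih =>
    rw [Function.iterate_succ_apply', ih]
    simp only [pderiv_monomial]
    rw [tsub_tsub, ← Finsupp.single_add, Nat.descFactorial_succ]
    congr 1
    simp
    ring

theorem Eb_eq (k l n m : ℕ) : Eb k l n m =
    monomial (Finsupp.single 0 n + Finsupp.single 1 (k - n) + Finsupp.single 2 m
      + Finsupp.single 3 (l - m)) 1 := by
  simp [Eb, X_pow_eq_monomial, monomial_mul]

theorem Dop_Eb (k l n m a b : ℕ) (hn : n ≤ k) (hm : m ≤ l) (ha : a ≤ k) (hb : b ≤ l) :
    Dop a (k - a) b (l - b) (Eb k l n m) =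
      if a = n ∧ b = m then C ((n.factorial * (k - n).factorial * m.factorial *
        (l - m).factorial : ℕ) : ℂ) else 0 := by
  rw [Eb_eq]
  unfold Dop
  simp only [iter_pderiv]
  split_ifs with h
  · obtain ⟨rfl, rfl⟩ := h
    rw [← monomial_zero']
    refine congrArg₂ (fun s c => monomial s c) ?_ ?_
    · refine Finsupp.ext fun t => ?_
      fin_cases t <;> simp
    · simp [Nat.descFactorial_self]
      ring
  · rw [monomial_eq_zero]
    simp
    have : (n < a ∨ k - n < k - a) ∨ (m < b ∨ l - m < l - b) := by omega
    tauto

theorem stmt8 (k l n m i j : ℕ) (hn : n ≤ k) (hi : i ≤ k) (hm : m ≤ l) (hj : j ≤ l) :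
    symProd k l k l (k : ℤ) (l : ℤ) (Eb k l n m) (Eb k l i j) =
      if n = k - i ∧ m = l - j then
        MvPolynomial.C ((-1 : ℂ) ^ (n + m) * ((k.choose n : ℂ))⁻¹ * ((l.choose m : ℂ))⁻¹)
      else 0 := by
  unfold symProd
  rw [if_pos (by simp)]
  simp only [Int.toNat_natCast]
  have key : ∀ a ∈ Finset.range (k + 1), ∀ b ∈ Finset.range (l + 1),
      Dop (k - a) a (l - b) b (Eb k l i j) =
      if k - a = i ∧ l - b = j then C ((i.factorial * (k - i).factorial * j.factorial *
        (l - j).factorial : ℕ) : ℂ) else 0 := by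
    intro a ha b hb
    simp only [Finset.mem_range] at ha hb
    have := Dop_Eb k l i j (k - a) (l - b) hi hj (by omega) (by omega)
    rwa [Nat.sub_sub_self (by omega), Nat.sub_sub_self (by omega)] at this
  rw [Finset.sum_eq_single_of_mem n (by simp; omega), Finset.sum_eq_single_of_mem m (by simp; omega)]
  · rw [key n (by simp; omega) m (by simp; omega), Dop_Eb k l n m n m hn hm hn hm]
    rw [if_pos ⟨rfl, rfl⟩]
    by_cases h : n = k - i ∧ m = l - j
    · rw [if_pos h, if_pos (by omega)]
      have h1 : i = k - n := by omega
      have h2 : j = l - m := by omega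
      subst h1 h2
      rw [Nat.sub_sub_self hn, Nat.sub_sub_self hm, ← C_mul, smul_eq_C_mul, smul_eq_C_mul,
        ← C_mul, ← C_mul]
      congr 1
      rw [Nat.cast_choose ℂ hn, Nat.cast_choose ℂ hm]
      have f : ∀ t : ℕ, (t.factorial : ℂ) ≠ 0 := fun t => by exact_mod_cast t.factorial_ne_zero
      have := f k
      have := f l
      have := f n
      have := f m
      have := f (k - n)
      have := f (l - m)
      push_cast
      simp only [Nat.sub_self, Nat.factorial_zero, Nat.cast_one]
      field_simp
    · rw [if_neg h, if_neg (by omega)]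
      simp
  · intro b hb hbm
    simp only [Finset.mem_range] at hb
    rw [Dop_Eb k l n m n b hn hm hn (by omega), if_neg (by tauto)]
    simp
  · intro a ha han
    refine Finset.sum_eq_zero fun b hb => ?_
    simp only [Finset.mem_range] at ha hb
    rw [Dop_Eb k l n m a b hn hm (by omega) (by omega), if_neg (by tauto)]
    simp
end
end

section
/- Contraction rules of basis elements with valence-(1,1) basis elements (equations (Basis11vec)): for all k,l ≥ 1 and 0 ≤ n ≤ k, 0 ≤ m ≤ l: (i) E^{n,m}_{k,l} ⊙_{1,1} E^{0,0}_{1,1} = (m·n)/(k·l) · E^{n−1,m−1}_{k−1,l−1}; (ii) E^{n,m}_{k,l} ⊙_{1,1} E^{1,0}_{1,1} = −(m·(k−n))/(k·l) · E^{n,m−1}_{k−1,l−1}; (iii) E^{n,m}_{k,l} ⊙_{1,1} E^{0,1}_{1,1} = −(n·(l−m))/(k·l) · E^{n−1,m}_{k−1,l−1}; (iv) E^{n,m}_{k,l} ⊙_{1,1} E^{1,1}_{1,1} = ((k−n)·(l−m))/(k·l) · E^{n,m}_{k−1,l−1}; here basis elements E with out-of-range superscripts are interpreted as 0 (their scalar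 prefactors vanish in those cases). -/
open MvPolynomial Finset

noncomputable section

lemma symProd_one (k l : ℕ) (hk : 1 ≤ k) (hl : 1 ≤ l) (φ ψ : MvPolynomial (Fin 4) ℂ) :
    symProd k l 1 1 (1 : ℤ) (1 : ℤ) φ ψ = (1 / ((k : ℂ) * (l : ℂ))) •
      (pderiv 1 (pderiv 3 φ) * pderiv 0 (pderiv 2 ψ) - pderiv 1 (pderiv 2 φ) * pderiv 0 (pderiv 3 ψ)
        - pderiv 0 (pderiv 3 φ) * pderiv 1 (pderiv 2 ψ)
        + pderiv 0 (pderiv 2 φ) * pderiv 1 (pderiv 3 ψ)) := by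
  have hc : (0:ℤ) ≤ 1 ∧ (1:ℤ) ≤ min (k : ℤ) ((1:ℕ) : ℤ) ∧ (0:ℤ) ≤ 1 ∧
      (1:ℤ) ≤ min (l : ℤ) ((1:ℕ) : ℤ) := by
    simp; omega
  unfold symProd
  rw [if_pos hc]
  obtain ⟨k, rfl⟩ : ∃ j, k = j + 1 := ⟨k - 1, by omega⟩
  obtain ⟨l, rfl⟩ : ∃ j, l = j + 1 := ⟨l - 1, by omega⟩
  congr 1
  · have h1 : ((k.factorial : ℕ) : ℂ) ≠ 0 := by exact_mod_cast k.factorial_ne_zero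
    have h2 : ((l.factorial : ℕ) : ℂ) ≠ 0 := by exact_mod_cast l.factorial_ne_zero
    have h3 : (k : ℂ) + 1 ≠ 0 := by exact_mod_cast k.succ_ne_zero
    have h4 : (l : ℂ) + 1 ≠ 0 := by exact_mod_cast l.succ_ne_zero
    simp [Nat.factorial_succ]
    field_simp
  · simp [Finset.sum_range_succ, Dop]
    ring

lemma pd_mono (a b c d : ℕ) :
    (pderiv 0 (X 0 ^ a * X 1 ^ b * X 2 ^ c * X 3 ^ d : MvPolynomial (Fin 4) ℂ) =
      (a : ℂ) • (X 0 ^ (a - 1) * X 1 ^ b * X 2 ^ c * X 3 ^ d)) ∧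
    (pderiv 1 (X 0 ^ a * X 1 ^ b * X 2 ^ c * X 3 ^ d : MvPolynomial (Fin 4) ℂ) =
      (b : ℂ) • (X 0 ^ a * X 1 ^ (b - 1) * X 2 ^ c * X 3 ^ d)) ∧
    (pderiv 2 (X 0 ^ a * X 1 ^ b * X 2 ^ c * X 3 ^ d : MvPolynomial (Fin 4) ℂ) =
      (c : ℂ) • (X 0 ^ a * X 1 ^ b * X 2 ^ (c - 1) * X 3 ^ d)) ∧
    (pderiv 3 (X 0 ^ a * X 1 ^ b * X 2 ^ c * X 3 ^ d : MvPolynomial (Fin 4) ℂ) =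
      (d : ℂ) • (X 0 ^ a * X 1 ^ b * X 2 ^ c * X 3 ^ (d - 1))) := by
  refine ⟨?_, ?_, ?_, ?_⟩ <;>
  · simp [Derivation.leibniz, Derivation.leibniz_pow, pderiv_X, MvPolynomial.smul_eq_C_mul]
    try ring

/-- Contraction rules of basis elements with valence-(1,1) basis elements
(equations (Basis11vec)); out-of-range basis elements on the right-hand sides
are harmless since their scalar prefactors vanish in those cases. -/
theorem stmt11 (k l n m : ℕ) (hk : 1 ≤ k) (hl : 1 ≤ l) (hn : n ≤ k) (hm : m ≤ l) :
    symProd k l 1 1 (1 : ℤ) (1 : ℤ) (Eb k l n m) (Eb 1 1 0 0) =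
        (((m : ℂ) * (n : ℂ)) / ((k : ℂ) * (l : ℂ))) • Eb (k - 1) (l - 1) (n - 1) (m - 1) ∧
    symProd k l 1 1 (1 : ℤ) (1 : ℤ) (Eb k l n m) (Eb 1 1 1 0) =
        (-(((m : ℂ) * ((k : ℂ) - (n : ℂ))) / ((k : ℂ) * (l : ℂ)))) •
          Eb (k - 1) (l - 1) n (m - 1) ∧
    symProd k l 1 1 (1 : ℤ) (1 : ℤ) (Eb k l n m) (Eb 1 1 0 1) =
        (-(((n : ℂ) * ((l : ℂ) - (m : ℂ))) / ((k : ℂ) * (l : ℂ)))) •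
          Eb (k - 1) (l - 1) (n - 1) m ∧
    symProd k l 1 1 (1 : ℤ) (1 : ℤ) (Eb k l n m) (Eb 1 1 1 1) =
        ((((k : ℂ) - (n : ℂ)) * ((l : ℂ) - (m : ℂ))) / ((k : ℂ) * (l : ℂ))) •
          Eb (k - 1) (l - 1) n m := by
  simp only [symProd_one k l hk hl, Eb, (pd_mono _ _ _ _).1, (pd_mono _ _ _ _).2.1,
    (pd_mono _ _ _ _).2.2.1, (pd_mono _ _ _ _).2.2.2, Derivation.map_smul]
  obtain ⟨p, rfl⟩ := Nat.exists_eq_add_of_le hn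
  obtain ⟨q, rfl⟩ := Nat.exists_eq_add_of_le hm
  have hx : n = 0 ∨ n + p - 1 - (n - 1) = p := by omega
  have hy : m = 0 ∨ m + q - 1 - (m - 1) = q := by omega
  have hp : n + p - 1 - n = p - 1 := by omega
  have hq : m + q - 1 - m = q - 1 := by omega
  refine ⟨?_, ?_, ?_, ?_⟩
  · rcases hx with rfl | hx
    · simp
    rcases hy with rfl | hy
    · simp
    rw [hx, hy]
    simp [smul_smul, div_eq_mul_inv, mul_comm, mul_left_comm]
  · rcases hy with rfl | hy
    · simp
    rw [hp, hy]
    simp [smul_smul, div_eq_mul_inv, mul_comm, mul_left_comm]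
  · rcases hx with rfl | hx
    · simp
    rw [hx, hq]
    simp [smul_smul, div_eq_mul_inv, mul_comm, mul_left_comm]
  · rw [hp, hq]
    simp [smul_smul, div_eq_mul_inv, mul_comm, mul_left_comm]
end
end

section
/- Characterization of the coefficients in a first-order symmetric-spinor condition (the worked example of Section 3.2, in the binary-form model): let K ∈ S_4 and L, M ∈ S_2 be homogeneous polynomials in (x,y) of degrees 4, 2, 2 respectively. Then K ⊙_2 (L ⊙_1 φ) + M ⊙_1 φ = 0 holds for every φ ∈ S_2 if and only if K ⊙_1 L = 0 and M = (1/2) · (K ⊙_2 L). -/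
open MvPolynomial Finset

noncomputable section

/-- Binary quadratic form with normalized coefficients. -/
def q2 (a b c : ℂ) : MvPolynomial (Fin 2) ℂ :=
  C a * X 0 ^ 2 + C (2 * b) * (X 0 * X 1) + C c * X 1 ^ 2

/-- Binary quartic form with plain coefficients. -/
def r4 (a b c d e : ℂ) : MvPolynomial (Fin 2) ℂ :=
  C a * X 0 ^ 4 + C b * (X 0 ^ 3 * X 1) + C c * (X 0 ^ 2 * X 1 ^ 2)
    + C d * (X 0 * X 1 ^ 3) + C e * X 1 ^ 4

lemma hom_expand (n : ℕ) (P : MvPolynomial (Fin 2) ℂ) (h : P.IsHomogeneous n) :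
    ∃ f : ℕ → ℂ, P = ∑ i ∈ Finset.range (n + 1), C (f i) * (X 0 ^ i * X 1 ^ (n - i)) := by
  refine ⟨fun i => coeff (Finsupp.single 0 i + Finsupp.single 1 (n - i)) P, ?_⟩
  have hm : ∀ (i : ℕ) (c : ℂ), (C c * (X 0 ^ i * X 1 ^ (n - i)) : MvPolynomial (Fin 2) ℂ)
      = monomial (Finsupp.single 0 i + Finsupp.single 1 (n - i)) c := by
    intro i c
    rw [X_pow_eq_monomial, X_pow_eq_monomial, monomial_mul, C_mul_monomial]
    simp
  simp only [hm]
  ext d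
  rw [coeff_sum]
  simp only [coeff_monomial]
  by_cases hd : d 0 + d 1 = n
  · rw [Finset.sum_eq_single (d 0)]
    · have : Finsupp.single 0 (d 0) + Finsupp.single 1 (n - d 0) = d := by
        ext j
        fin_cases j <;> simp <;> omega
      rw [this]; simp
    · intro b _ hb
      rw [if_neg]
      intro h'
      apply hb
      rw [← h']; simp
    · intro h'
      simp at h'
      omega
  · rw [Finset.sum_eq_zero]
    · apply h.coeff_eq_zero
      rw [Finsupp.degree_eq_sum]
      simpa using hd
    · intro i hi
      rw [if_neg]
      intro h'
      apply hd
      rw [← h']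
      simp at hi ⊢
      omega

lemma exists_q2 (P : MvPolynomial (Fin 2) ℂ) (h : P.IsHomogeneous 2) :
    ∃ a b c, P = q2 a b c := by
  obtain ⟨f, rfl⟩ := hom_expand 2 P h
  refine ⟨f 2, f 1 / 2, f 0, ?_⟩
  have : 2 * (f 1 / 2) = f 1 := by ring
  simp [Finset.sum_range_succ, q2, this, -C_mul]
  ring

lemma exists_r4 (P : MvPolynomial (Fin 2) ℂ) (h : P.IsHomogeneous 4) :
    ∃ a b c d e, P = r4 a (4 * b) (6 * c) (4 * d) e := by
  obtain ⟨f, rfl⟩ := hom_expand 4 P h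
  refine ⟨f 4, f 3 / 4, f 2 / 6, f 1 / 4, f 0, ?_⟩
  have h1 : 4 * (f 1 / 4) = f 1 := by ring
  have h2 : 6 * (f 2 / 6) = f 2 := by ring
  have h3 : 4 * (f 3 / 4) = f 3 := by ring
  rw [h1, h2, h3]
  simp [Finset.sum_range_succ, r4]
  ring

lemma q2_hom (a b c : ℂ) : (q2 a b c).IsHomogeneous 2 := by
  unfold q2
  refine ((?_ : IsHomogeneous _ 2).add ?_).add ?_
  · exact (isHomogeneous_X_pow 0 2).C_mul a
  · exact ((isHomogeneous_X ℂ 0).mul (isHomogeneous_X ℂ 1)).C_mul _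
  · exact (isHomogeneous_X_pow 1 2).C_mul c

lemma q2_inj {a b c a' b' c' : ℂ} :
    q2 a b c = q2 a' b' c' ↔ a = a' ∧ b = b' ∧ c = c' := by
  constructor
  · intro h
    have e := fun u v : ℂ => congrArg (eval ![u, v]) h
    have e1 := e 1 0
    have e2 := e 0 1
    have e3 := e 1 1
    simp [q2] at e1 e2 e3
    refine ⟨e1, ?_, e2⟩
    linear_combination (e3 - e1 - e2) / 2
  · rintro ⟨rfl, rfl, rfl⟩; rfl

lemma r4_zero {a b c d e : ℂ} :
    r4 a b c d e = 0 ↔ a = 0 ∧ b = 0 ∧ c = 0 ∧ d = 0 ∧ e = 0 := by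
  constructor
  · intro h
    have e := fun u v : ℂ => congrArg (eval ![u, v]) h
    have e1 := e 1 0
    have e2 := e 0 1
    have e3 := e 1 1
    have e4 := e 1 (-1)
    have e5 := e 1 2
    simp [r4] at e1 e2 e3 e4 e5
    subst e1 e2
    refine ⟨rfl, ?_, ?_, ?_, rfl⟩ <;> grind
  · rintro ⟨rfl, rfl, rfl, rfl, rfl⟩; simp [r4]

lemma q2_add (a b c a' b' c' : ℂ) :
    q2 a b c + q2 a' b' c' = q2 (a + a') (b + b') (c + c') := by
  simp only [q2, C_add, C_mul]; ring

lemma q2_smul (t a b c : ℂ) : t • q2 a b c = q2 (t * a) (t * b) (t * c) := by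
  simp only [q2, C_add, C_mul, smul_eq_C_mul]; ring

lemma C_two : (C 2 : MvPolynomial (Fin 2) ℂ) = 2 := map_ofNat C 2

lemma C_three : (C 3 : MvPolynomial (Fin 2) ℂ) = 3 := map_ofNat C 3

lemma C_four : (C 4 : MvPolynomial (Fin 2) ℂ) = 4 := map_ofNat C 4

lemma p0_q2 (a b c : ℂ) : pderiv 0 (q2 a b c) = C (2 * a) * X 0 + C (2 * b) * X 1 := by
  simp [q2, pderiv_X, Derivation.leibniz, Derivation.leibniz_pow]; simp only [C_two, C_three, C_four]; ring

lemma p1_q2 (a b c : ℂ) : pderiv 1 (q2 a b c) = C (2 * b) * X 0 + C (2 * c) * X 1 := by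
  simp [q2, pderiv_X, Derivation.leibniz, Derivation.leibniz_pow]; simp only [C_two, C_three, C_four]; ring

lemma p0_lin (a b : ℂ) : pderiv (0 : Fin 2) (C a * X 0 + C b * X 1) = C a := by
  simp [pderiv_X, Derivation.leibniz]

lemma p1_lin (a b : ℂ) : pderiv (1 : Fin 2) (C a * X 0 + C b * X 1) = C b := by
  simp [pderiv_X, Derivation.leibniz]

/-- Binary cubic form. -/
def r3 (a b c d : ℂ) : MvPolynomial (Fin 2) ℂ :=
  C a * X 0 ^ 3 + C b * (X 0 ^ 2 * X 1) + C c * (X 0 * X 1 ^ 2) + C d * X 1 ^ 3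

lemma p0_r4 (a b c d e : ℂ) : pderiv 0 (r4 a b c d e) = r3 (4 * a) (3 * b) (2 * c) d := by
  simp [r4, r3, pderiv_X, Derivation.leibniz, Derivation.leibniz_pow]; simp only [C_two, C_three, C_four]; ring

lemma p1_r4 (a b c d e : ℂ) : pderiv 1 (r4 a b c d e) = r3 b (2 * c) (3 * d) (4 * e) := by
  simp [r4, r3, pderiv_X, Derivation.leibniz, Derivation.leibniz_pow]; simp only [C_two, C_three, C_four]; ring

lemma p0_r3 (a b c d : ℂ) : pderiv 0 (r3 a b c d) = q2 (3 * a) b c := by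
  simp [q2, r3, pderiv_X, Derivation.leibniz, Derivation.leibniz_pow]; simp only [C_two, C_three, C_four]; ring

lemma p1_r3 (a b c d : ℂ) : pderiv 1 (r3 a b c d) = q2 b c (3 * d) := by
  simp [q2, r3, pderiv_X, Derivation.leibniz, Derivation.leibniz_pow]; simp only [C_two, C_three, C_four]; ring

lemma prod221 (a b c a' b' c' : ℂ) : symProd1 2 2 1 (q2 a b c) (q2 a' b' c') =
    q2 (b * a' - a * b') ((c * a' - a * c') / 2) (c * b' - b * c') := by
  apply MvPolynomial.funext
  intro v
  simp [symProd1, Dxy, Finset.sum_range_succ, p0_q2, p1_q2, Nat.factorial]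
  simp [q2]
  ring

lemma prod422 (k0 k1 k2 k3 k4 a b c : ℂ) :
    symProd1 4 2 2 (r4 k0 (4 * k1) (6 * k2) (4 * k3) k4) (q2 a b c) =
    q2 (k2 * a - 2 * k1 * b + k0 * c) (k3 * a - 2 * k2 * b + k1 * c)
      (k4 * a - 2 * k3 * b + k2 * c) := by
  apply MvPolynomial.funext
  intro v
  simp only [symProd1, Dxy, Finset.sum_range_succ, p0_q2, p1_q2, p0_lin, p1_lin, p0_r4, p1_r4,
    p0_r3, p1_r3, Nat.factorial, Function.iterate_succ, Function.iterate_zero, Function.comp, id,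
    Finset.sum_range_zero, Nat.sub_self, Nat.sub_zero, Nat.reduceSub, Nat.reduceAdd]
  simp [q2, smul_eval]
  ring

lemma prod421 (k0 k1 k2 k3 k4 a b c : ℂ) :
    symProd1 4 2 1 (r4 k0 (4 * k1) (6 * k2) (4 * k3) k4) (q2 a b c) =
    r4 (k1 * a - k0 * b) (3 * k2 * a - 2 * k1 * b - k0 * c) (3 * k3 * a - 3 * k1 * c)
      (2 * k3 * b + k4 * a - 3 * k2 * c) (k4 * b - k3 * c) := by
  apply MvPolynomial.funext
  intro v
  simp [symProd1, Dxy, Finset.sum_range_succ, p0_q2, p1_q2, p0_r4, p1_r4, Nat.factorial]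
  simp [r4, r3]
  ring

/-- The worked example of Section 3.2 (binary-form model): characterization of the
coefficients in a first-order symmetric-spinor condition. -/
theorem stmt13 (K L M : MvPolynomial (Fin 2) ℂ)
    (hK : K.IsHomogeneous 4) (hL : L.IsHomogeneous 2) (hM : M.IsHomogeneous 2) :
    (∀ φ : MvPolynomial (Fin 2) ℂ, φ.IsHomogeneous 2 →
        symProd1 4 2 2 K (symProd1 2 2 1 L φ) + symProd1 2 2 1 M φ = 0) ↔
      (symProd1 4 2 1 K L = 0 ∧ M = (1 / 2 : ℂ) • symProd1 4 2 2 K L) := by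
  obtain ⟨k0, k1, k2, k3, k4, rfl⟩ := exists_r4 K hK
  obtain ⟨l0, l1, l2, rfl⟩ := exists_q2 L hL
  obtain ⟨m0, m1, m2, rfl⟩ := exists_q2 M hM
  have hz : (0 : MvPolynomial (Fin 2) ℂ) = q2 0 0 0 := by simp [q2]
  rw [prod421, prod422, q2_smul, q2_inj, r4_zero]
  constructor
  · intro h
    have key := fun a b c => h _ (q2_hom a b c)
    simp only [prod221, prod422, q2_add] at key
    simp only [hz, q2_inj] at key
    have h0 := key 1 0 0
    have h1 := key 0 1 0
    have h2 := key 0 0 1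
    clear key h hM hK hL
    grind
  · rintro ⟨⟨h0, h1, h2, h3, h4⟩, e0, e1, e2⟩ φ hφ
    obtain ⟨a, b, c, rfl⟩ := exists_q2 φ hφ
    simp only [prod221, prod422, q2_add]
    rw [hz, q2_inj]
    clear hM hK hL hφ
    subst e0 e1 e2
    refine ⟨?_, ?_, ?_⟩ <;> grind
end
end

section
/- Rearrangement identity for the test-spinor contraction in the worked example of Section 3.2 (in the binary-form model): for all K ∈ S_4 and L, M, T, φ ∈ S_2 (homogeneous polynomials in (x,y) of degrees 4, 2, 2, 2, 2 respectively), the following identity of complex numbers holds: T ⊙_2 ( K ⊙_2 (L ⊙_1 φ) ) + T ⊙_2 ( M ⊙_1 φ ) = K ⊙_4 ( L ⊙_1 (T ⊙_0 φ) ) + (1/2) · K ⊙_4 ( L ⊙_0 (T ⊙_1 φ) ) − M ⊙_2 ( T ⊙_1 φ ). -/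
open MvPolynomial Finset

noncomputable section

/-- A binary quadratic form in scaled coefficients. -/
def quadF (a b c : ℂ) : MvPolynomial (Fin 2) ℂ :=
  C a * X 0 ^ 2 + C (2 * b) * (X 0 * X 1) + C c * X 1 ^ 2

/-- A binary quartic form in scaled coefficients. -/
def quartF (a b c d e : ℂ) : MvPolynomial (Fin 2) ℂ :=
  C a * X 0 ^ 4 + C (4 * b) * (X 0 ^ 3 * X 1) + C (6 * c) * (X 0 ^ 2 * X 1 ^ 2)
    + C (4 * d) * (X 0 * X 1 ^ 3) + C e * X 1 ^ 4

lemma exists_homog (n : ℕ) (P : MvPolynomial (Fin 2) ℂ) (hP : P.IsHomogeneous n) :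
    ∃ c : ℕ → ℂ, P = ∑ j ∈ Finset.range (n + 1), C (c j) * (X 0 ^ (n - j) * X 1 ^ j) := by
  have key : ∀ s : Finset (Fin 2 →₀ ℕ), s ⊆ P.support →
      ∃ c : ℕ → ℂ, ∑ v ∈ s, monomial v (coeff v P)
        = ∑ j ∈ Finset.range (n + 1), C (c j) * (X 0 ^ (n - j) * X 1 ^ j) := by
    intro s
    induction s using Finset.induction_on with
    | empty => intro _; exact ⟨fun _ => 0, by simp⟩
    | insert v s hv ih =>
      intro hs
      obtain ⟨c, hc⟩ := ih (fun w hw => hs (Finset.mem_insert_of_mem hw))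
      have hvP : coeff v P ≠ 0 := by
        simpa using hs (Finset.mem_insert_self v s)
      have hd := hP hvP
      have hd' : v 0 + v 1 = n := by
        rw [Finsupp.weight_apply, Finsupp.sum_fintype _ _ (by simp)] at hd
        simpa using hd
      refine ⟨fun j => (if j = v 1 then coeff v P else 0) + c j, ?_⟩
      rw [Finset.sum_insert hv, hc]
      simp only [map_add, add_mul, Finset.sum_add_distrib]
      congr 1
      rw [Finset.sum_eq_single (v 1)]
      · have h0 : n - v 1 = v 0 := by omega
        rw [h0, if_pos rfl, monomial_eq, Finsupp.prod_fintype _ _ (by simp)]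
        simp
      · intro j _ hj
        simp [hj]
      · intro h
        exact absurd (Finset.mem_range.2 (by omega)) h
  obtain ⟨c, hc⟩ := key P.support (fun _ h => h)
  exact ⟨c, by rw [← hc]; exact P.as_sum⟩

lemma exists_quad (P : MvPolynomial (Fin 2) ℂ) (hP : P.IsHomogeneous 2) :
    ∃ a b c, P = quadF a b c := by
  obtain ⟨c, rfl⟩ := exists_homog 2 P hP
  refine ⟨c 0, c 1 / 2, c 2, ?_⟩
  rw [quadF, mul_div_cancel₀ _ (by norm_num)]
  simp [Finset.sum_range_succ]

lemma exists_quart (P : MvPolynomial (Fin 2) ℂ) (hP : P.IsHomogeneous 4) :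
    ∃ a b c d e, P = quartF a b c d e := by
  obtain ⟨c, rfl⟩ := exists_homog 4 P hP
  refine ⟨c 0, c 1 / 4, c 2 / 6, c 3 / 4, c 4, ?_⟩
  rw [quartF, mul_div_cancel₀ _ (by norm_num), mul_div_cancel₀ _ (by norm_num),
    mul_div_cancel₀ _ (by norm_num)]
  simp [Finset.sum_range_succ]

lemma pderiv_ofNat (i : Fin 2) (n : ℕ) [n.AtLeastTwo] :
    pderiv i (OfNat.ofNat n : MvPolynomial (Fin 2) ℂ) = 0 :=
  Derivation.map_natCast (pderiv i) n

/-- A binary cubic form in scaled coefficients. -/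
def cubF (a b c d : ℂ) : MvPolynomial (Fin 2) ℂ :=
  C a * X 0 ^ 3 + C (3 * b) * (X 0 ^ 2 * X 1) + C (3 * c) * (X 0 * X 1 ^ 2) + C d * X 1 ^ 3

/-- A binary linear form. -/
def linF (a b : ℂ) : MvPolynomial (Fin 2) ℂ := C a * X 0 + C b * X 1

lemma quart0 (a b c d e : ℂ) : pderiv 0 (quartF a b c d e) = C 4 * cubF a b c d := by
  apply MvPolynomial.funext
  intro v
  simp [quadF, quartF, cubF, linF, pderiv_X, Derivation.leibniz, Derivation.leibniz_pow,
    pderiv_ofNat]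
  try ring

lemma quart1 (a b c d e : ℂ) : pderiv 1 (quartF a b c d e) = C 4 * cubF b c d e := by
  apply MvPolynomial.funext
  intro v
  simp [quadF, quartF, cubF, linF, pderiv_X, Derivation.leibniz, Derivation.leibniz_pow,
    pderiv_ofNat]
  try ring

lemma cub0 (a b c d : ℂ) : pderiv 0 (cubF a b c d) = C 3 * quadF a b c := by
  apply MvPolynomial.funext
  intro v
  simp [quadF, quartF, cubF, linF, pderiv_X, Derivation.leibniz, Derivation.leibniz_pow,
    pderiv_ofNat]
  try ring

lemma cub1 (a b c d : ℂ) : pderiv 1 (cubF a b c d) = C 3 * quadF b c d := by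
  apply MvPolynomial.funext
  intro v
  simp [quadF, quartF, cubF, linF, pderiv_X, Derivation.leibniz, Derivation.leibniz_pow,
    pderiv_ofNat]
  try ring

lemma quad0 (a b c : ℂ) : pderiv 0 (quadF a b c) = C 2 * linF a b := by
  apply MvPolynomial.funext
  intro v
  simp [quadF, quartF, cubF, linF, pderiv_X, Derivation.leibniz, Derivation.leibniz_pow,
    pderiv_ofNat]
  try ring

lemma quad1 (a b c : ℂ) : pderiv 1 (quadF a b c) = C 2 * linF b c := by
  apply MvPolynomial.funext
  intro v
  simp [quadF, quartF, cubF, linF, pderiv_X, Derivation.leibniz, Derivation.leibniz_pow,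
    pderiv_ofNat]
  try ring

lemma lin0 (a b : ℂ) : pderiv 0 (linF a b) = C a := by
  apply MvPolynomial.funext
  intro v
  simp [quadF, quartF, cubF, linF, pderiv_X, Derivation.leibniz, Derivation.leibniz_pow,
    pderiv_ofNat]
  try ring

lemma lin1 (a b : ℂ) : pderiv 1 (linF a b) = C b := by
  apply MvPolynomial.funext
  intro v
  simp [quadF, quartF, cubF, linF, pderiv_X, Derivation.leibniz, Derivation.leibniz_pow,
    pderiv_ofNat]
  try ring

lemma sp222 (a b c p q r : ℂ) : symProd1 2 2 2 (quadF a b c) (quadF p q r)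
    = C (a * r - 2 * b * q + c * p) := by
  apply MvPolynomial.funext
  intro v
  simp only [symProd1, Dxy, Finset.sum_range_succ, Finset.sum_range_zero, Function.iterate_succ,
    Function.iterate_zero, Function.comp, id, pderiv_C_mul, quart0, quart1, cub0, cub1,
    quad0, quad1, lin0, lin1, Nat.reduceSub, Nat.reduceAdd]
  simp [quadF, linF, Nat.factorial, Nat.choose, smul_eval]
  ring

lemma sp221 (a b c p q r : ℂ) : symProd1 2 2 1 (quadF a b c) (quadF p q r)
    = quadF (b * p - a * q) ((c * p - a * r) / 2) (c * q - b * r) := by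
  apply MvPolynomial.funext
  intro v
  simp [symProd1, Dxy, quadF, quartF, Finset.sum_range_succ, Nat.factorial, Nat.choose,
    pderiv_X, Pi.single_apply, Derivation.leibniz, Derivation.leibniz_pow, smul_eval, pderiv_ofNat]
  ring

lemma sp220 (a b c p q r : ℂ) : symProd1 2 2 0 (quadF a b c) (quadF p q r)
    = quartF (a * p) ((a * q + b * p) / 2) ((a * r + 4 * b * q + c * p) / 6)
      ((b * r + c * q) / 2) (c * r) := by
  apply MvPolynomial.funext
  intro v
  simp [symProd1, Dxy, quadF, quartF, Finset.sum_range_succ, Nat.factorial, Nat.choose,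
    pderiv_X, Pi.single_apply, Derivation.leibniz, Derivation.leibniz_pow, smul_eval, pderiv_ofNat]
  ring

lemma sp241 (a b c p q r s t : ℂ) : symProd1 2 4 1 (quadF a b c) (quartF p q r s t)
    = quartF (b * p - a * q) ((c * p + 2 * b * q - 3 * a * r) / 4)
      ((c * q - a * s) / 2)
      ((3 * c * r - 2 * b * s - a * t) / 4) (c * s - b * t) := by
  apply MvPolynomial.funext
  intro v
  simp [symProd1, Dxy, quadF, quartF, Finset.sum_range_succ, Nat.factorial, Nat.choose,
    pderiv_X, Pi.single_apply, Derivation.leibniz, Derivation.leibniz_pow, smul_eval, pderiv_ofNat]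
  ring

lemma sp422 (a b c p q r s t : ℂ) : symProd1 4 2 2 (quartF p q r s t) (quadF a b c)
    = quadF (p * c - 2 * q * b + r * a) (q * c - 2 * r * b + s * a)
      (r * c - 2 * s * b + t * a) := by
  apply MvPolynomial.funext
  intro v
  simp only [symProd1, Dxy, Finset.sum_range_succ, Finset.sum_range_zero, Function.iterate_succ,
    Function.iterate_zero, Function.comp, id, pderiv_C_mul, quart0, quart1, cub0, cub1,
    quad0, quad1, lin0, lin1, Nat.reduceSub, Nat.reduceAdd]
  simp [quadF, linF, Nat.factorial, Nat.choose, smul_eval]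
  ring

lemma sp444 (a b c d e p q r s t : ℂ) :
    symProd1 4 4 4 (quartF a b c d e) (quartF p q r s t)
    = C (a * t - 4 * b * s + 6 * c * r - 4 * d * q + e * p) := by
  apply MvPolynomial.funext
  intro v
  simp only [symProd1, Dxy, Finset.sum_range_succ, Finset.sum_range_zero, Function.iterate_succ,
    Function.iterate_zero, Function.comp, id, pderiv_C_mul, quart0, quart1, cub0, cub1,
    quad0, quad1, lin0, lin1, Nat.reduceSub, Nat.reduceAdd]
  simp [quadF, linF, Nat.factorial, Nat.choose, smul_eval]
  ring

/-- Rearrangement identity for the test-spinor contraction in the worked example of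
Section 3.2 (binary-form model); all terms lie in `S_0 = ℂ` (constant polynomials). -/
theorem stmt14 (K L M T φ : MvPolynomial (Fin 2) ℂ)
    (hK : K.IsHomogeneous 4) (hL : L.IsHomogeneous 2) (hM : M.IsHomogeneous 2)
    (hT : T.IsHomogeneous 2) (hφ : φ.IsHomogeneous 2) :
    symProd1 2 2 2 T (symProd1 4 2 2 K (symProd1 2 2 1 L φ)) +
        symProd1 2 2 2 T (symProd1 2 2 1 M φ) =
      symProd1 4 4 4 K (symProd1 2 4 1 L (symProd1 2 2 0 T φ)) +
        (1 / 2 : ℂ) • symProd1 4 4 4 K (symProd1 2 2 0 L (symProd1 2 2 1 T φ)) -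
        symProd1 2 2 2 M (symProd1 2 2 1 T φ) := by
  obtain ⟨k0, k1, k2, k3, k4, rfl⟩ := exists_quart K hK
  obtain ⟨l0, l1, l2, rfl⟩ := exists_quad L hL
  obtain ⟨m0, m1, m2, rfl⟩ := exists_quad M hM
  obtain ⟨t0, t1, t2, rfl⟩ := exists_quad T hT
  obtain ⟨f0, f1, f2, rfl⟩ := exists_quad φ hφ
  rw [sp221, sp422, sp222, sp221, sp222, sp220, sp241, sp444, sp221, sp220, sp444, sp222,
    smul_eq_C_mul]
  simp only [← C_mul, ← C_add, ← C_sub]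
  congr 1
  ring
end
end
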